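/- Let L be a positive definite, integral, strongly square free, totally-reflective ℤ-lattice of rank 3, and write det L = q₁⋯q_s with pairwise distinct primes q₁, …, q_s. Then s ≤ 9. -/

import Mathlib

open Matrix

/-- The bilinear form attached to a Gram matrix `G` on `ℤ^m`. -/
def Bf {m : ℕ} (G : Matrix (Fin m) (Fin m) ℤ) (x y : Fin m → ℤ) : ℤ :=
  x ⬝ᵥ G.mulVec y

/-- A vector of the lattice `ℤ^m` is primitive if it is not a proper multiple of a lattice
vector. -/
def PrimVec {m : ℕ} (v : Fin m → ℤ) : Prop :=
  ∀ c : ℤ, 1 < c → ¬∃ w : Fin m → ℤ, c • w = v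

/-- `v` is a root of the lattice `(ℤ^m, G)`: it is nonzero, primitive, and the associated
reflection `x ↦ x − (2·b(x,v)/b(v,v))·v` maps the lattice into itself. -/
def IsRootM {m : ℕ} (G : Matrix (Fin m) (Fin m) ℤ) (v : Fin m → ℤ) : Prop :=
  v ≠ 0 ∧ PrimVec v ∧
    ∀ x : Fin m → ℤ, ∃ y : Fin m → ℤ, ∀ i,
      (y i : ℚ) = (x i : ℚ) - 2 * (Bf G x v : ℚ) / (Bf G v v : ℚ) * (v i : ℚ)

/-- The lattice `(ℤ^m, G)` is reflective if its roots span a sublattice of full rank. -/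
def ReflectiveM {m : ℕ} (G : Matrix (Fin m) (Fin m) ℤ) : Prop :=
  Module.finrank ℤ (Submodule.span ℤ {v : Fin m → ℤ | IsRootM G v}) = m

/-- Positive definiteness of the Gram matrix `G`. -/
def PosDefM {m : ℕ} (G : Matrix (Fin m) (Fin m) ℤ) : Prop :=
  ∀ v : Fin m → ℤ, v ≠ 0 → 0 < Bf G v v

/-- Two integral lattices, given by Gram matrices, are in the same genus if the Gram
matrices are congruent over the ring `ℤ_p` of `p`-adic integers for every prime `p`. -/
def SameGenusM {m : ℕ} (G₁ G₂ : Matrix (Fin m) (Fin m) ℤ) : Prop :=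
  ∀ (p : ℕ) [Fact p.Prime],
    ∃ S : Matrix (Fin m) (Fin m) ℤ_[p], IsUnit S.det ∧
      Sᵀ * G₁.map (Int.cast : ℤ → ℤ_[p]) * S = G₂.map (Int.cast : ℤ → ℤ_[p])

/-- The lattice `(ℤ^m, G)` is totally-reflective if every lattice in its genus is
reflective. -/
def TotallyReflectiveM {m : ℕ} (G : Matrix (Fin m) (Fin m) ℤ) : Prop :=
  ∀ G' : Matrix (Fin m) (Fin m) ℤ, G'.IsSymm → PosDefM G' → SameGenusM G G' → ReflectiveM G'

/-- The lattice `(ℤ^m, G)` is square free: all elementary divisors of `G` are square free. -/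
def SquareFreeM {m : ℕ} (G : Matrix (Fin m) (Fin m) ℤ) : Prop :=
  ∃ (S T : Matrix (Fin m) (Fin m) ℤ) (d : Fin m → ℤ),
    IsUnit S.det ∧ IsUnit T.det ∧ S * G * T = Matrix.diagonal d ∧ ∀ i, Squarefree (d i)

/-- Strongly square free: square free and `v_p(det) ≤ m/2` for every prime `p`. -/
def StronglySquareFreeM {m : ℕ} (G : Matrix (Fin m) (Fin m) ℤ) : Prop :=
  SquareFreeM G ∧ ∀ p : ℕ, p.Prime → (G.det.natAbs).factorization p ≤ m / 2


section BasicForm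

variable {G : Matrix (Fin 3) (Fin 3) ℤ}

theorem Bf_add_left (x y z : Fin 3 → ℤ) : Bf G (x + y) z = Bf G x z + Bf G y z := by
  simp [Bf, add_dotProduct]

theorem Bf_add_right (x y z : Fin 3 → ℤ) : Bf G x (y + z) = Bf G x y + Bf G x z := by
  simp [Bf, Matrix.mulVec_add, dotProduct_add]

theorem Bf_sub_left (x y z : Fin 3 → ℤ) : Bf G (x - y) z = Bf G x z - Bf G y z := by
  simp [Bf, sub_dotProduct]

theorem Bf_sub_right (x y z : Fin 3 → ℤ) : Bf G x (y - z) = Bf G x y - Bf G x z := by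
  simp [Bf, Matrix.mulVec_sub, dotProduct_sub]

theorem Bf_smul_left (c : ℤ) (x y : Fin 3 → ℤ) : Bf G (c • x) y = c * Bf G x y := by
  unfold Bf
  rw [smul_dotProduct, smul_eq_mul]

theorem Bf_smul_right (c : ℤ) (x y : Fin 3 → ℤ) : Bf G x (c • y) = c * Bf G x y := by
  unfold Bf
  rw [Matrix.mulVec_smul, dotProduct_smul, smul_eq_mul]

theorem Bf_comm (hG : G.IsSymm) (x y : Fin 3 → ℤ) : Bf G x y = Bf G y x := by
  unfold Bf
  rw [Matrix.dotProduct_mulVec, ← Matrix.mulVec_transpose, hG.eq, dotProduct_comm]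

theorem Bf_congr (U : Matrix (Fin 3) (Fin 3) ℤ) (x y : Fin 3 → ℤ) :
    Bf (Uᵀ * G * U) x y = Bf G (U.mulVec x) (U.mulVec y) := by
  unfold Bf
  rw [← Matrix.mulVec_mulVec, ← Matrix.mulVec_mulVec, Matrix.dotProduct_mulVec,
    Matrix.vecMul_transpose]

theorem gcd_bez3 (a b c : ℤ) :
    ∃ p q r : ℤ, ((Int.gcd a (Int.gcd b c) : ℕ) : ℤ) = p * a + q * b + r * c := by
  have h1 := Int.gcd_eq_gcd_ab a (Int.gcd b c)
  have h2 := Int.gcd_eq_gcd_ab b c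
  refine ⟨Int.gcdA a (Int.gcd b c), Int.gcdB a (Int.gcd b c) * Int.gcdA b c,
    Int.gcdB a (Int.gcd b c) * Int.gcdB b c, ?_⟩
  linear_combination h1 + Int.gcdB a (Int.gcd b c) * h2

/-- Bezout coefficients for a primitive vector. -/
theorem prim_bezout {v : Fin 3 → ℤ} (hv : PrimVec v) :
    ∃ a b c : ℤ, a * v 0 + b * v 1 + c * v 2 = 1 := by
  have key : ((Int.gcd (v 0) (Int.gcd (v 1) (v 2)) : ℕ) : ℤ) = 1 := by
    set g : ℕ := Int.gcd (v 0) (Int.gcd (v 1) (v 2)) with hg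
    have h0 : (g : ℤ) ∣ v 0 := Int.gcd_dvd_left ..
    have h12 : (g : ℤ) ∣ (Int.gcd (v 1) (v 2) : ℕ) := Int.gcd_dvd_right ..
    have h1 : (g : ℤ) ∣ v 1 := h12.trans (Int.gcd_dvd_left ..)
    have h2 : (g : ℤ) ∣ v 2 := h12.trans (Int.gcd_dvd_right ..)
    rcases Nat.lt_trichotomy g 1 with h | h | h
    · have hz : g = 0 := by omega
      rw [hz] at h0 h1 h2
      simp only [Nat.cast_zero, zero_dvd_iff] at h0 h1 h2
      exact absurd ⟨0, by ext i; fin_cases i <;> simp [h0, h1, h2]⟩ (hv 2 (by norm_num))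
    · exact_mod_cast h
    · obtain ⟨a, ha⟩ := h0
      obtain ⟨b, hb⟩ := h1
      obtain ⟨c, hc⟩ := h2
      exact absurd ⟨![a, b, c], by ext i; fin_cases i <;> simp [ha, hb, hc]⟩
        (hv g (by exact_mod_cast h))
  obtain ⟨p, q, r, h⟩ := gcd_bez3 (v 0) (v 1) (v 2)
  exact ⟨p, q, r, by rw [← h, key]⟩

theorem prim_dvd {v : Fin 3 → ℤ} (hv : PrimVec v) {n k : ℤ} (h : ∀ i, n ∣ k * v i) : n ∣ k := by
  obtain ⟨a, b, c, habc⟩ := prim_bezout hv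
  have : k = a * (k * v 0) + b * (k * v 1) + c * (k * v 2) := by linear_combination (-k) * habc
  rw [this]
  exact dvd_add (dvd_add ((h 0).mul_left _) ((h 1).mul_left _)) ((h 2).mul_left _)

theorem prim_parallel {f y : Fin 3 → ℤ} (hf : PrimVec f) (h : ∀ i j, y i * f j = y j * f i) :
    ∃ k : ℤ, y = k • f := by
  obtain ⟨a, b, c, habc⟩ := prim_bezout hf
  refine ⟨a * y 0 + b * y 1 + c * y 2, ?_⟩
  ext i
  simp only [Pi.smul_apply, smul_eq_mul]
  linear_combination (-(y i)) * habc + a * h i 0 + b * h i 1 + c * h i 2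

/-- If a nonzero multiple of `y` is a multiple of the primitive `f`, then so is `y`. -/
theorem prim_smul_parallel {f y : Fin 3 → ℤ} (hf : PrimVec f) {n k : ℤ} (hn : n ≠ 0)
    (h : n • y = k • f) : ∃ k : ℤ, y = k • f := by
  refine prim_parallel hf fun i j => ?_
  have hi := congrFun h i
  have hj := congrFun h j
  simp only [Pi.smul_apply, smul_eq_mul] at hi hj
  apply mul_left_cancel₀ hn
  linear_combination f j * hi - f i * hj

theorem exists_prim {v : Fin 3 → ℤ} (hv : v ≠ 0) :
    ∃ (w : Fin 3 → ℤ) (g : ℤ), g ≠ 0 ∧ PrimVec w ∧ v = g • w := by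
  set g : ℕ := Int.gcd (v 0) (Int.gcd (v 1) (v 2)) with hg
  have h0 : (g : ℤ) ∣ v 0 := Int.gcd_dvd_left ..
  have h12 : (g : ℤ) ∣ (Int.gcd (v 1) (v 2) : ℕ) := Int.gcd_dvd_right ..
  have h1 : (g : ℤ) ∣ v 1 := h12.trans (Int.gcd_dvd_left ..)
  have h2 : (g : ℤ) ∣ v 2 := h12.trans (Int.gcd_dvd_right ..)
  have hgne : (g : ℤ) ≠ 0 := by
    intro hz
    rw [hz] at h0 h1 h2
    simp only [zero_dvd_iff] at h0 h1 h2
    exact hv (by ext i; fin_cases i <;> simp [h0, h1, h2])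
  have hbez : ∃ p q r : ℤ, (g : ℤ) = p * v 0 + q * v 1 + r * v 2 :=
    gcd_bez3 (v 0) (v 1) (v 2)
  obtain ⟨a, ha⟩ := h0
  obtain ⟨b, hb⟩ := h1
  obtain ⟨c, hc⟩ := h2
  obtain ⟨p, q, r, hpqr⟩ := hbez
  have hone : p * a + q * b + r * c = 1 := by
    apply mul_left_cancel₀ hgne
    rw [ha, hb, hc] at hpqr
    linear_combination -hpqr
  refine ⟨![a, b, c], g, hgne, ?_, by ext i; fin_cases i <;> simp [ha, hb, hc]⟩
  rintro k hk ⟨w, hw⟩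
  have e0 := congrFun hw 0
  have e1 := congrFun hw 1
  have e2 := congrFun hw 2
  simp only [Pi.smul_apply, smul_eq_mul, Matrix.cons_val] at e0 e1 e2
  have : k ∣ 1 := ⟨p * w 0 + q * w 1 + r * w 2, by
    linear_combination -hone - p * e0 - q * e1 - r * e2⟩
  have := Int.le_of_dvd one_pos this
  omega

/-- Divisibility form of the root condition. -/
structure Rt (G : Matrix (Fin 3) (Fin 3) ℤ) (v : Fin 3 → ℤ) : Prop where
  ne : v ≠ 0
  prim : PrimVec v
  dvd : ∀ x, Bf G v v ∣ 2 * Bf G x v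

theorem IsRootM.rt (hpos : PosDefM G) {v : Fin 3 → ℤ} (h : IsRootM G v) : Rt G v := by
  obtain ⟨hne, hprim, hr⟩ := h
  refine ⟨hne, hprim, fun x => ?_⟩
  obtain ⟨y, hy⟩ := hr x
  have hn : ((Bf G v v : ℤ) : ℚ) ≠ 0 := by exact_mod_cast (hpos v hne).ne'
  refine prim_dvd hprim fun i => ⟨x i - y i, ?_⟩
  have := hy i
  field_simp at this
  have h2 : ((2 * Bf G x v * v i : ℤ) : ℚ) = ((Bf G v v * (x i - y i) : ℤ) : ℚ) := by
    push_cast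
    linarith
  exact_mod_cast h2

theorem PosDefM.eq_zero (hpos : PosDefM G) {v : Fin 3 → ℤ} (h : Bf G v v = 0) : v = 0 := by
  by_contra hv
  exact (hpos v hv).ne' h

/-- Reflections in roots map roots to roots. -/
theorem Rt.reflect (hG : G.IsSymm) (hpos : PosDefM G) {v w : Fin 3 → ℤ} (hv : Rt G v)
    (hw : Rt G w) {c : ℤ} (hc : 2 * Bf G w v = Bf G v v * c) : Rt G (w - c • v) := by
  have hn := (hpos v hv.ne).ne'
  have key : ∀ x, ∃ k : ℤ, 2 * Bf G x v = Bf G v v * k ∧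
      Bf G x (w - c • v) = Bf G (x - k • v) w := by
    intro x
    obtain ⟨k, hk⟩ := hv.dvd x
    refine ⟨k, hk, ?_⟩
    rw [Bf_sub_right, Bf_smul_right, Bf_sub_left, Bf_smul_left, Bf_comm hG v w]
    apply mul_left_cancel₀ hn
    have h2 : 2 * (Bf G v v * (c * Bf G x v)) = 2 * (Bf G v v * (k * Bf G w v)) := by
      linear_combination (Bf G v v * c) * hk - (Bf G v v * k) * hc
    linarith
  have hnorm : Bf G (w - c • v) (w - c • v) = Bf G w w := by
    simp only [Bf_sub_right, Bf_smul_right, Bf_sub_left, Bf_smul_left, Bf_comm hG v w]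
    linear_combination (-c) * hc
  have hprim : PrimVec (w - c • v) := by
    rintro k hk ⟨u, hu⟩
    obtain ⟨a, ha⟩ := hv.dvd u
    refine hw.prim k hk ⟨u - a • v, ?_⟩
    have hka : k * a = -c := by
      apply mul_left_cancel₀ hn
      have h1 : Bf G (k • u) v = Bf G (w - c • v) v := by rw [hu]
      rw [Bf_smul_left, Bf_sub_left, Bf_smul_left] at h1
      linear_combination (-k) * ha + 2 * h1 + hc
    rw [smul_sub, hu, smul_smul, hka]
    ext i
    simp
  refine ⟨?_, hprim, fun x => ?_⟩
  · intro h0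
    rw [h0] at hnorm
    have : Bf G w w = 0 := by rw [← hnorm]; simp [Bf]
    exact hw.ne (hpos.eq_zero this)
  · obtain ⟨k, -, hk⟩ := key x
    rw [hnorm, hk]
    exact hw.dvd _

/-- A reflective lattice has a root outside the kernel of any nonzero functional. -/
theorem exists_root_not_ker (hpos : PosDefM G) (hr : ReflectiveM G) {a : Fin 3 → ℤ} (ha : a ≠ 0) :
    ∃ v, Rt G v ∧ a ⬝ᵥ v ≠ 0 := by
  by_contra hcon
  push Not at hcon
  set l : (Fin 3 → ℤ) →ₗ[ℤ] ℤ := dotProductBilin ℤ ℤ a with hl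
  have hle : Submodule.span ℤ {v : Fin 3 → ℤ | IsRootM G v} ≤ LinearMap.ker l := by
    rw [Submodule.span_le]
    intro v hv
    simpa [hl] using hcon v (IsRootM.rt hpos hv)
  have h1 := Submodule.finrank_mono hle
  have h2 := Submodule.finrank_quotient_add_finrank (LinearMap.ker l)
  rw [l.quotKerEquivRange.finrank_eq] at h2
  rw [ReflectiveM] at hr
  have h3 : Module.finrank ℤ (Fin 3 → ℤ) = 3 := by simp
  have h4 : Module.finrank ℤ (LinearMap.range l) = 0 := by omega
  have h5 : LinearMap.range l = ⊥ := Submodule.finrank_eq_zero.mp h4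
  rw [LinearMap.range_eq_bot] at h5
  apply ha
  have h6 : l a = 0 := by rw [h5]; rfl
  have h7 : a ⬝ᵥ a = 0 := by simpa [hl] using h6
  exact dotProduct_self_eq_zero.mp h7

end BasicForm


section FrameExistence

variable {G : Matrix (Fin 3) (Fin 3) ℤ}

theorem gram_apply (E : Matrix (Fin 3) (Fin 3) ℤ) (i j : Fin 3) :
    (E * G * Eᵀ) i j = Bf G (E i) (E j) := by
  unfold Bf
  rw [Matrix.dotProduct_mulVec, Matrix.mul_apply, dotProduct]
  refine Finset.sum_congr rfl fun k _ => ?_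
  rw [Matrix.transpose_apply, Matrix.mul_apply, Matrix.vecMul, dotProduct]

theorem gram_det (hG : G.IsSymm) {e1 e2 e3 : Fin 3 → ℤ} (h12 : Bf G e1 e2 = 0)
    (h13 : Bf G e1 e3 = 0) (h23 : Bf G e2 e3 = 0) :
    Bf G e1 e1 * Bf G e2 e2 * Bf G e3 e3 = (Matrix.of ![e1, e2, e3]).det ^ 2 * G.det := by
  have h : (Matrix.of ![e1, e2, e3] * G * (Matrix.of ![e1, e2, e3])ᵀ).det =
      Bf G e1 e1 * Bf G e2 e2 * Bf G e3 e3 := by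
    rw [Matrix.det_fin_three]
    have a0 : (Matrix.of ![e1, e2, e3]) 0 = e1 := rfl
    have a1 : (Matrix.of ![e1, e2, e3]) 1 = e2 := rfl
    have a2 : (Matrix.of ![e1, e2, e3]) 2 = e3 := rfl
    simp only [gram_apply, a0, a1, a2]
    simp [h12, h13, h23, Bf_comm hG e2 e1, Bf_comm hG e3 e1, Bf_comm hG e3 e2]
  rw [← h, Matrix.det_mul, Matrix.det_mul, Matrix.det_transpose]
  ring

theorem orth_zero (hG : G.IsSymm) (hpos : PosDefM G) {e1 e2 e3 w : Fin 3 → ℤ} (h12 : Bf G e1 e2 = 0)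
    (h13 : Bf G e1 e3 = 0) (h23 : Bf G e2 e3 = 0) (n1 : e1 ≠ 0) (n2 : e2 ≠ 0) (n3 : e3 ≠ 0)
    (w1 : Bf G w e1 = 0) (w2 : Bf G w e2 = 0) (w3 : Bf G w e3 = 0) : w = 0 := by
  have hd := gram_det hG h12 h13 h23
  have p1 := hpos e1 n1
  have p2 := hpos e2 n2
  have p3 := hpos e3 n3
  have hne : (Matrix.of ![e1, e2, e3] * G).det ≠ 0 := by
    intro h0
    rw [Matrix.det_mul] at h0
    have : (Matrix.of ![e1, e2, e3]).det ^ 2 * G.det = 0 := by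
      rw [sq, mul_assoc, h0, mul_zero]
    rw [this] at hd
    have : 0 < Bf G e1 e1 * Bf G e2 e2 * Bf G e3 e3 := by positivity
    omega
  refine Matrix.eq_zero_of_mulVec_eq_zero hne ?_
  rw [Bf_comm hG] at w1 w2 w3
  rw [← Matrix.mulVec_mulVec]
  ext i
  fin_cases i
  · exact w1
  · exact w2
  · exact w3

theorem Rt.cauchy (hG : G.IsSymm) (hpos : PosDefM G) {v w : Fin 3 → ℤ} (hv : v ≠ 0) 
    (hind : ∀ a b : ℤ, a • v + b • w = 0 → b = 0) :
    Bf G v w * Bf G v w < Bf G v v * Bf G w w := by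
  have hn := hpos v hv
  have hu : Bf G v v • w - Bf G v w • v ≠ 0 := by
    intro h0
    have := hind (-Bf G v w) (Bf G v v) (by rw [← h0]; simp [neg_smul]; abel)
    omega
  have := hpos _ hu
  simp only [Bf_sub_right, Bf_smul_right, Bf_sub_left, Bf_smul_left, Bf_comm hG w v] at this
  have h2 : 0 < Bf G v v * (Bf G v v * Bf G w w - Bf G v w * Bf G v w) := by
    linarith
  have := (mul_pos_iff_of_pos_left hn).mp h2
  linarith

/-- Two independent non-orthogonal roots: either there is an orthogonal pair of roots, or the two
roots have equal norm and the Cartan integers are `±1`. -/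
theorem pair_cases (hG : G.IsSymm) (hpos : PosDefM G) {v w : Fin 3 → ℤ} (hv : Rt G v) (hw : Rt G w)
    (hind : ∀ a b : ℤ, a • v + b • w = 0 → b = 0)
    (hno : ∀ x y, Rt G x → Rt G y → Bf G x y ≠ 0) :
    ∃ c : ℤ, (c = 1 ∨ c = -1) ∧ 2 * Bf G v w = c * Bf G v v ∧ Bf G v v = Bf G w w := by
  have pv := hpos v hv.ne
  have pw := hpos w hw.ne
  have hC := Rt.cauchy hG hpos hv.ne hind
  have hb := hno v w hv hw
  obtain ⟨c, hc⟩ := hw.dvd v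
  obtain ⟨c', hc'⟩ := hv.dvd w
  have hc'2 := hc'
  rw [Bf_comm hG w v] at hc'
  set b := Bf G v w with hbdef
  have hcc : c * c' * (Bf G v v * Bf G w w) = 4 * (b * b) := by
    linear_combination (-(2 * b)) * hc - (Bf G w w * c) * hc'
  have hbb : 0 < b * b := mul_self_pos.mpr hb
  have hnn : 0 < Bf G v v * Bf G w w := by positivity
  have hlt : c * c' < 4 := by nlinarith
  have hgt : 0 < c * c' := by
    by_contra h
    push Not at h
    nlinarith
  -- reflect `v` in `w`
  have r1 : Rt G (v - c • w) := hw.reflect hG hpos hv (by rw [← hc])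
  have r1' : Rt G (w - c' • v) := hv.reflect hG hpos hw (by rw [← hc'2])
  have hc0 : c ≠ 0 := by rintro rfl; simp at hgt
  have hc0' : c' ≠ 0 := by rintro rfl; simp at hgt
  have hcle : |c| ≤ 3 := by
    have h1 : |c| * |c'| = c * c' := by rw [← abs_mul, abs_of_pos hgt]
    have h2 : 1 ≤ |c'| := Int.one_le_abs hc0'
    have h3 := abs_nonneg c
    nlinarith
  have hcle' : |c'| ≤ 3 := by
    have h1 : |c| * |c'| = c * c' := by rw [← abs_mul, abs_of_pos hgt]
    have h2 : 1 ≤ |c| := Int.one_le_abs hc0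
    have h3 := abs_nonneg c'
    nlinarith
  have hcc3 : c * c' = 1 ∨ c * c' = 2 ∨ c * c' = 3 := by omega
  -- the case of ratio two
  have two : c * c' ≠ 2 := by
    intro h2
    have hor : (c = 1 ∨ c = -1) ∨ (c' = 1 ∨ c' = -1) := by
      rw [abs_le] at hcle hcle'
      obtain ⟨a1, a2⟩ := hcle
      interval_cases c <;> omega
    rcases hor with h | h
    · refine hno v (v - c • w) hv r1 ?_
      rw [Bf_sub_right, Bf_smul_right, ← hbdef]
      have : 2 * (c * b) = 2 * Bf G v v := by linear_combination c * hc' + Bf G v v * h2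
      linarith
    · refine hno w (w - c' • v) hw r1' ?_
      rw [Bf_sub_right, Bf_smul_right, Bf_comm hG w v, ← hbdef]
      have : 2 * (c' * b) = 2 * Bf G w w := by linear_combination c' * hc + Bf G w w * h2
      linarith
  have three : c * c' ≠ 3 := by
    intro h3
    have hor : (c = 1 ∨ c = -1) ∨ (c' = 1 ∨ c' = -1) := by
      rw [abs_le] at hcle hcle'
      obtain ⟨a1, a2⟩ := hcle
      interval_cases c <;> omega
    rcases hor with h | h
    · have hcb : 2 * (c * b) = 3 * Bf G v v := by linear_combination c * hc' + Bf G v v * h3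
      have r2 : Rt G ((v - c • w) - (-1 : ℤ) • v) := by
        refine hv.reflect hG hpos r1 ?_
        rw [Bf_sub_left, Bf_smul_left, Bf_comm hG w v, ← hbdef]
        linear_combination -hcb
      refine hno w _ hw r2 ?_
      rw [Bf_sub_right, Bf_sub_right, Bf_smul_right, Bf_smul_right, Bf_comm hG w v, ← hbdef]
      linear_combination hc
    · have hcb : 2 * (c' * b) = 3 * Bf G w w := by linear_combination c' * hc + Bf G w w * h3
      have r2 : Rt G ((w - c' • v) - (-1 : ℤ) • w) := by
        refine hw.reflect hG hpos r1' ?_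
        rw [Bf_sub_left, Bf_smul_left, ← hbdef]
        linear_combination -hcb
      refine hno v _ hv r2 ?_
      rw [Bf_sub_right, Bf_sub_right, Bf_smul_right, Bf_smul_right, ← hbdef]
      linear_combination hc'
  have one : c * c' = 1 := by tauto
  rcases Int.mul_eq_one_iff_eq_one_or_neg_one.mp one with ⟨h1, h2⟩ | ⟨h1, h2⟩
  · exact ⟨1, Or.inl rfl, by rw [hc', h2]; ring, by rw [h1] at hc; rw [h2] at hc'; linarith⟩
  · exact ⟨-1, Or.inr rfl, by rw [hc', h2]; ring, by rw [h1] at hc; rw [h2] at hc'; linarith⟩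

/-- Three independent roots exist. -/
theorem exists_three_roots (hpos : PosDefM G) (hr : ReflectiveM G) :
    ∃ v1 v2 v3 : Fin 3 → ℤ, Rt G v1 ∧ Rt G v2 ∧ Rt G v3 ∧ (Matrix.of ![v1, v2, v3]).det ≠ 0 := by
  obtain ⟨v1, h1, -⟩ := exists_root_not_ker hpos hr (a := ![1, 0, 0])
    (fun h => by simpa using congrFun h 0)
  have h1ne : ∃ a : Fin 3 → ℤ, a ≠ 0 ∧ a ⬝ᵥ v1 = 0 := by
    by_cases h0 : v1 0 = 0 ∧ v1 1 = 0
    · refine ⟨![1, 0, 0], fun h => by simpa using congrFun h 0, ?_⟩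
      simp [dotProduct, Fin.sum_univ_three, h0.1]
    · refine ⟨![v1 1, - v1 0, 0], fun h => h0 ⟨?_, ?_⟩, ?_⟩
      · simpa using congrFun h 1
      · simpa using congrFun h 0
      · simp [dotProduct, Fin.sum_univ_three]; ring
  obtain ⟨a, ha, hav⟩ := h1ne
  obtain ⟨v2, h2, hav2⟩ := exists_root_not_ker hpos hr ha
  have hcross : ![v1 1 * v2 2 - v1 2 * v2 1, v1 2 * v2 0 - v1 0 * v2 2,
      v1 0 * v2 1 - v1 1 * v2 0] ≠ (0 : Fin 3 → ℤ) := by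
    intro h
    have e0 := congrFun h 0
    have e1 := congrFun h 1
    have e2 := congrFun h 2
    simp only [Matrix.cons_val, Pi.zero_apply] at e0 e1 e2
    obtain ⟨k, hk⟩ := prim_parallel (f := v1) (y := v2) h1.prim (fun i j => by
      fin_cases i <;> fin_cases j <;> simp <;> linarith)
    apply hav2
    rw [hk, dotProduct_smul, hav, smul_zero]
  obtain ⟨v3, h3, hv3⟩ := exists_root_not_ker hpos hr hcross
  refine ⟨v1, v2, v3, h1, h2, h3, ?_⟩
  intro hd
  apply hv3
  rw [← hd, Matrix.det_fin_three]
  simp [dotProduct, Fin.sum_univ_three]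
  ring

theorem ind_of_det {u v w : Fin 3 → ℤ} (hd : (Matrix.of ![u, v, w]).det ≠ 0) {a b c : ℤ}
    (h : a • u + b • v + c • w = 0) : a = 0 ∧ b = 0 ∧ c = 0 := by
  have := Matrix.eq_zero_of_vecMul_eq_zero hd (v := ![a, b, c]) (by
    ext i
    have := congrFun h i
    simpa [Matrix.vecMul, dotProduct, Fin.sum_univ_three] using this)
  exact ⟨by simpa using congrFun this 0, by simpa using congrFun this 1,
    by simpa using congrFun this 2⟩

theorem exists_orth_pair (hG : G.IsSymm) (hpos : PosDefM G) (hr : ReflectiveM G) :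
    ∃ x y, Rt G x ∧ Rt G y ∧ Bf G x y = 0 := by
  by_contra hcon
  have hno : ∀ x y, Rt G x → Rt G y → Bf G x y ≠ 0 := fun x y hx hy h => hcon ⟨x, y, hx, hy, h⟩
  obtain ⟨v1, v2, v3, h1, h2, h3, hd⟩ := exists_three_roots hpos hr
  obtain ⟨c12, k12, e12, f12⟩ := pair_cases hG hpos h1 h2
    (fun a b h => (ind_of_det hd (a := a) (b := b) (c := 0) (by simpa using h)).2.1) hno
  obtain ⟨c13, k13, e13, f13⟩ := pair_cases hG hpos h1 h3
    (fun a b h => (ind_of_det hd (a := a) (b := 0) (c := b) (by simpa using h)).2.2) hno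
  obtain ⟨c23, k23, e23, f23⟩ := pair_cases hG hpos h2 h3
    (fun a b h => (ind_of_det hd (a := 0) (b := a) (c := b) (by simpa using h)).2.2) hno
  have s12 : c12 * c12 = 1 := by rcases k12 with h | h <;> rw [h] <;> norm_num
  have s23 : c23 * c23 = 1 := by rcases k23 with h | h <;> rw [h] <;> norm_num
  have s13 : c13 * c13 = 1 := by rcases k13 with h | h <;> rw [h] <;> norm_num
  have hprod : c13 = c12 * c23 ∨ c13 = - (c12 * c23) := by
    rcases k12 with h | h <;> rcases k13 with h' | h' <;> rcases k23 with h'' | h'' <;>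
      rw [h, h', h''] <;> norm_num
  rw [← f12] at e23
  rcases hprod with hp | hp
  · have r : Rt G (v1 - c12 • v2) := h2.reflect hG hpos h1 (by rw [← f12]; linear_combination e12)
    refine hno _ _ r h3 ?_
    rw [Bf_sub_left, Bf_smul_left]
    have : 2 * (Bf G v1 v3 - c12 * Bf G v2 v3) = 0 := by
      linear_combination e13 - c12 * e23 + Bf G v1 v1 * hp
    linarith
  · have hz : Bf G (v1 - c12 • v2 - c13 • v3) (v1 - c12 • v2 - c13 • v3) = 0 := by
      simp only [Bf_sub_right, Bf_smul_right, Bf_sub_left, Bf_smul_left, Bf_comm hG v2 v1,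
        Bf_comm hG v3 v1, Bf_comm hG v3 v2]
      rw [← f12, ← f13]
      linear_combination (-c12) * e12 - c13 * e13 + c12 * c13 * e23 + c12 * c23 * Bf G v1 v1 * hp
        - Bf G v1 v1 * c12 * c12 * s23 - Bf G v1 v1 * s12
    have := hpos.eq_zero hz
    have := (ind_of_det hd (a := 1) (b := -c12) (c := -c13) (by
      rw [← this]; simp [neg_smul]; abel)).1
    omega

/-- An orthogonal frame of three roots. -/
theorem exists_orth_triple (hG : G.IsSymm) (hpos : PosDefM G) (hr : ReflectiveM G) :
    ∃ e1 e2 e3, Rt G e1 ∧ Rt G e2 ∧ Rt G e3 ∧ Bf G e1 e2 = 0 ∧ Bf G e1 e3 = 0 ∧ Bf G e2 e3 = 0 := by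
  obtain ⟨e1, e2, h1, h2, h12⟩ := exists_orth_pair hG hpos hr
  obtain ⟨w, hw, hMw⟩ : ∃ w : Fin 3 → ℤ, w ≠ 0 ∧
      (Matrix.of ![G.mulVec e1, G.mulVec e2, 0]).mulVec w = 0 := by
    rw [Matrix.exists_mulVec_eq_zero_iff]
    exact Matrix.det_eq_zero_of_row_eq_zero 2 (fun j => by simp)
  obtain ⟨e3, g, hg, hp, hge⟩ := exists_prim hw
  have o1 : Bf G e1 e3 = 0 := by
    have h := congrFun hMw 0
    have h' : Bf G w e1 = 0 := by
      unfold Bf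
      rw [dotProduct_comm]
      exact h
    rw [hge, Bf_smul_left, Bf_comm hG] at h'
    exact (mul_eq_zero.mp h').resolve_left hg
  have o2 : Bf G e2 e3 = 0 := by
    have h := congrFun hMw 1
    have h' : Bf G w e2 = 0 := by
      unfold Bf
      rw [dotProduct_comm]
      exact h
    rw [hge, Bf_smul_left, Bf_comm hG] at h'
    exact (mul_eq_zero.mp h').resolve_left hg
  have h3 : e3 ≠ 0 := by
    rintro rfl
    exact hw (by rw [hge, smul_zero])
  refine ⟨e1, e2, e3, h1, h2, ⟨h3, hp, fun x => ?_⟩, h12, o1, o2⟩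
  obtain ⟨c1, hc1⟩ := h1.dvd x
  obtain ⟨c2, hc2⟩ := h2.dvd x
  have hn := (hpos e3 h3).ne'
  have hpar : Bf G e3 e3 • ((2 : ℤ) • x - c1 • e1 - c2 • e2) = (2 * Bf G x e3) • e3 := by
    rw [← sub_eq_zero]
    refine orth_zero hG hpos h12 o1 o2 h1.ne h2.ne h3 ?_ ?_ ?_
    · simp only [Bf_sub_left, Bf_smul_left, Bf_comm hG e2 e1, Bf_comm hG e3 e1, h12, o1]
      linear_combination Bf G e3 e3 * hc1
    · simp only [Bf_sub_left, Bf_smul_left, Bf_comm hG e3 e2, h12, o2]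
      linear_combination Bf G e3 e3 * hc2
    · simp only [Bf_sub_left, Bf_smul_left, o1, o2]
      ring
  obtain ⟨k, hk⟩ := prim_smul_parallel hp hn hpar
  refine ⟨k, ?_⟩
  have := congrArg (fun y => Bf G y e3) hk
  simp only [Bf_sub_left, Bf_smul_left, o1, o2] at this
  linear_combination this

end FrameExistence


section FrameInvariants

variable {G : Matrix (Fin 3) (Fin 3) ℤ}

/-- An orthogonal frame together with its numerical invariants. -/
structure Frame (G : Matrix (Fin 3) (Fin 3) ℤ) (e1 e2 e3 : Fin 3 → ℤ)
    (k1 k2 k3 d1 d2 d3 : ℤ) : Prop where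
  ne1 : e1 ≠ 0
  ne2 : e2 ≠ 0
  ne3 : e3 ≠ 0
  o12 : Bf G e1 e2 = 0
  o13 : Bf G e1 e3 = 0
  o23 : Bf G e2 e3 = 0
  n1 : Bf G e1 e1 = k1 * d1
  n2 : Bf G e2 e2 = k2 * d2
  n3 : Bf G e3 e3 = k3 * d3
  p1 : 0 < d1
  p2 : 0 < d2
  p3 : 0 < d3
  h1 : k1 = 1 ∨ k1 = 2
  h2 : k2 = 1 ∨ k2 = 2
  h3 : k3 = 1 ∨ k3 = 2
  dv1 : ∀ x, d1 ∣ Bf G x e1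
  dv2 : ∀ x, d2 ∣ Bf G x e2
  dv3 : ∀ x, d3 ∣ Bf G x e3
  prod : d1 * d2 * d3 = G.det
  kk : k1 * k2 * k3 ≤ 4

theorem Frame.swap12 (hG : G.IsSymm) {e1 e2 e3 : Fin 3 → ℤ} {k1 k2 k3 d1 d2 d3 : ℤ}
    (h : Frame G e1 e2 e3 k1 k2 k3 d1 d2 d3) : Frame G e2 e1 e3 k2 k1 k3 d2 d1 d3 :=
  ⟨h.ne2, h.ne1, h.ne3, by rw [Bf_comm hG, h.o12], h.o23, h.o13, h.n2, h.n1, h.n3, h.p2, h.p1, h.p3,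
    h.h2, h.h1, h.h3, h.dv2, h.dv1, h.dv3, by rw [← h.prod]; ring,
    by rw [mul_comm k2 k1]; exact h.kk⟩

theorem Frame.swap23 (hG : G.IsSymm) {e1 e2 e3 : Fin 3 → ℤ} {k1 k2 k3 d1 d2 d3 : ℤ}
    (h : Frame G e1 e2 e3 k1 k2 k3 d1 d2 d3) : Frame G e1 e3 e2 k1 k3 k2 d1 d3 d2 :=
  ⟨h.ne1, h.ne3, h.ne2, h.o13, h.o12, by rw [Bf_comm hG, h.o23], h.n1, h.n3, h.n2, h.p1, h.p3, h.p2,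
    h.h1, h.h3, h.h2, h.dv1, h.dv3, h.dv2, by rw [← h.prod]; ring,
    by have := h.kk; linarith [mul_right_comm k1 k3 k2]⟩

/-- An orthogonal triple of roots. -/
structure Orth3 (G : Matrix (Fin 3) (Fin 3) ℤ) (e1 e2 e3 : Fin 3 → ℤ) : Prop where
  r1 : Rt G e1
  r2 : Rt G e2
  r3 : Rt G e3
  o12 : Bf G e1 e2 = 0
  o13 : Bf G e1 e3 = 0
  o23 : Bf G e2 e3 = 0

theorem Orth3.swap12 (hG : G.IsSymm) {e1 e2 e3 : Fin 3 → ℤ} (h : Orth3 G e1 e2 e3) :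
    Orth3 G e2 e1 e3 :=
  ⟨h.r2, h.r1, h.r3, by rw [Bf_comm hG, h.o12], h.o23, h.o13⟩

theorem Orth3.swap23 (hG : G.IsSymm) {e1 e2 e3 : Fin 3 → ℤ} (h : Orth3 G e1 e2 e3) :
    Orth3 G e1 e3 e2 :=
  ⟨h.r1, h.r3, h.r2, h.o13, h.o12, by rw [Bf_comm hG, h.o23]⟩

theorem Orth3.dec (hG : G.IsSymm) (hpos : PosDefM G) {e1 e2 e3 : Fin 3 → ℤ} (h : Orth3 G e1 e2 e3)
    (x : Fin 3 → ℤ) {c1 c2 c3 : ℤ} (h1 : 2 * Bf G x e1 = Bf G e1 e1 * c1)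
    (h2 : 2 * Bf G x e2 = Bf G e2 e2 * c2) (h3 : 2 * Bf G x e3 = Bf G e3 e3 * c3) :
    (2 : ℤ) • x = c1 • e1 + c2 • e2 + c3 • e3 := by
  rw [← sub_eq_zero]
  refine orth_zero hG hpos h.o12 h.o13 h.o23 h.r1.ne h.r2.ne h.r3.ne ?_ ?_ ?_
  · simp only [Bf_sub_left, Bf_add_left, Bf_smul_left, Bf_comm hG e2 e1, Bf_comm hG e3 e1, h.o12, h.o13]
    linear_combination h1
  · simp only [Bf_sub_left, Bf_add_left, Bf_smul_left, Bf_comm hG e3 e2, h.o12, h.o23]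
    linear_combination h2
  · simp only [Bf_sub_left, Bf_add_left, Bf_smul_left, h.o13, h.o23]
    linear_combination h3

theorem two_smul_inj {x y : Fin 3 → ℤ} (h : (2 : ℤ) • x = (2 : ℤ) • y) : x = y := by
  ext i
  have := congrFun h i
  simp only [Pi.smul_apply, smul_eq_mul] at this
  omega

theorem Rt.no_half {e : Fin 3 → ℤ} (h : Rt G e) (y : Fin 3 → ℤ) (h2 : (2 : ℤ) • y = e) : False :=
  h.prim 2 (by norm_num) ⟨y, h2⟩

theorem Rt.no_single {e1 e2 e3 : Fin 3 → ℤ} (h : Rt G e1) (x : Fin 3 → ℤ) {c1 c2 c3 : ℤ}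
    (hx : (2 : ℤ) • x = c1 • e1 + c2 • e2 + c3 • e3) (h1 : ¬ 2 ∣ c1) (h2 : 2 ∣ c2) (h3 : 2 ∣ c3) :
    False := by
  obtain ⟨a2, rfl⟩ := h2
  obtain ⟨a3, rfl⟩ := h3
  obtain ⟨a1, rfl⟩ : ∃ a, c1 = 2 * a + 1 := ⟨c1 / 2, by omega⟩
  refine h.no_half (x - a1 • e1 - a2 • e2 - a3 • e3) ?_
  simp only [smul_sub, hx]
  module

theorem basis_det {u v w : Fin 3 → ℤ} (h : ∀ x : Fin 3 → ℤ, ∃ a b c : ℤ, x = a • u + b • v + c • w) :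
    (Matrix.of ![u, v, w]).det ^ 2 = 1 := by
  choose a b c hx using h
  set A : Matrix (Fin 3) (Fin 3) ℤ := Matrix.of fun i => ![a (Pi.single i 1), b (Pi.single i 1),
    c (Pi.single i 1)] with hA
  have : A * Matrix.of ![u, v, w] = 1 := by
    ext i j
    rw [Matrix.mul_apply, Fin.sum_univ_three, Matrix.one_apply]
    have := congrFun (hx (Pi.single i 1)) j
    simp only [Pi.add_apply, Pi.smul_apply, smul_eq_mul, Pi.single_apply] at this
    simp only [hA, Matrix.of_apply, Matrix.cons_val]
    rw [← this]
    simp [eq_comm]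
  have hd := congrArg Matrix.det this
  rw [Matrix.det_mul, Matrix.det_one] at hd
  rcases Int.mul_eq_one_iff_eq_one_or_neg_one.mp hd with ⟨_, h⟩ | ⟨_, h⟩ <;> rw [h] <;> norm_num

theorem even_norm {e x : Fin 3 → ℤ} {c : ℤ} (h : 2 * Bf G x e = Bf G e e * c) (hc : ¬ 2 ∣ c) :
    ∃ d, Bf G e e = 2 * d := by
  have : (2 : ℤ) ∣ Bf G e e * c := ⟨_, h.symm⟩
  exact (Int.prime_two.dvd_or_dvd this).resolve_right hc

theorem Rt.half_dvd {e : Fin 3 → ℤ} (h : Rt G e) {d : ℤ} (hd : Bf G e e = 2 * d) (x : Fin 3 → ℤ) :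
    d ∣ Bf G x e := by
  obtain ⟨c, hc⟩ := h.dvd x
  exact ⟨c, by rw [hd] at hc; linarith⟩

theorem par2 {a b : ℤ} (i1 : ¬ 2 ∣ a → 2 ∣ b → False) (i2 : ¬ 2 ∣ b → 2 ∣ a → False) :
    2 ∣ b - a := by
  by_cases ha : 2 ∣ a <;> by_cases hb : 2 ∣ b
  · omega
  · exact (i2 hb ha).elim
  · exact (i1 ha hb).elim
  · omega

theorem par3 {a b c : ℤ} (j1 : ¬ 2 ∣ a → 2 ∣ b → 2 ∣ c → False)
    (j2 : ¬ 2 ∣ b → 2 ∣ a → 2 ∣ c → False) (j3 : ¬ 2 ∣ c → 2 ∣ a → 2 ∣ b → False)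
    (j4 : ¬ 2 ∣ a → ¬ 2 ∣ b → ¬ 2 ∣ c → False) : 2 ∣ a + b + c := by
  by_cases ha : 2 ∣ a <;> by_cases hb : 2 ∣ b <;> by_cases hc : 2 ∣ c
  · omega
  · exact (j3 hc ha hb).elim
  · exact (j2 hb ha hc).elim
  · omega
  · exact (j1 ha hb hc).elim
  · omega
  · omega
  · exact (j4 ha hb hc).elim

theorem par6 {a b c : ℤ} (j1 : ¬ 2 ∣ a → 2 ∣ b → 2 ∣ c → False)
    (j2 : ¬ 2 ∣ b → 2 ∣ a → 2 ∣ c → False) (j3 : ¬ 2 ∣ c → 2 ∣ a → 2 ∣ b → False)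
    (k1 : ¬ 2 ∣ a - 1 → 2 ∣ b - 1 → 2 ∣ c - 1 → False)
    (k2 : ¬ 2 ∣ b - 1 → 2 ∣ a - 1 → 2 ∣ c - 1 → False)
    (k3 : ¬ 2 ∣ c - 1 → 2 ∣ a - 1 → 2 ∣ b - 1 → False) : 2 ∣ b - a ∧ 2 ∣ c - a := by
  by_cases ha : 2 ∣ a <;> by_cases hb : 2 ∣ b <;> by_cases hc : 2 ∣ c
  · omega
  · exact (j3 hc ha hb).elim
  · exact (j2 hb ha hc).elim
  · exact (k1 (by omega) (by omega) (by omega)).elim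
  · exact (j1 ha hb hc).elim
  · exact (k2 (by omega) (by omega) (by omega)).elim
  · exact (k3 (by omega) (by omega) (by omega)).elim
  · omega

/-- All coefficients even. -/
theorem frame_zero (hG : G.IsSymm) (hpos : PosDefM G) {e1 e2 e3 : Fin 3 → ℤ} (h : Orth3 G e1 e2 e3)
    (P1 : ∀ x, Bf G e1 e1 ∣ Bf G x e1) (P2 : ∀ x, Bf G e2 e2 ∣ Bf G x e2)
    (P3 : ∀ x, Bf G e3 e3 ∣ Bf G x e3) :
    Frame G e1 e2 e3 1 1 1 (Bf G e1 e1) (Bf G e2 e2) (Bf G e3 e3) := by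
  have hb : (Matrix.of ![e1, e2, e3]).det ^ 2 = 1 := by
    refine basis_det fun x => ?_
    obtain ⟨a, ha⟩ := P1 x
    obtain ⟨b, hb⟩ := P2 x
    obtain ⟨c, hc⟩ := P3 x
    refine ⟨a, b, c, two_smul_inj ?_⟩
    rw [h.dec hG hpos x (c1 := 2 * a) (c2 := 2 * b) (c3 := 2 * c) (by rw [ha]; ring)
      (by rw [hb]; ring) (by rw [hc]; ring)]
    module
  have hd := gram_det hG h.o12 h.o13 h.o23
  rw [hb, one_mul] at hd
  exact ⟨h.r1.ne, h.r2.ne, h.r3.ne, h.o12, h.o13, h.o23, by ring, by ring, by ring,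
    hpos _ h.r1.ne, hpos _ h.r2.ne, hpos _ h.r3.ne, Or.inl rfl, Or.inl rfl, Or.inl rfl, P1, P2, P3,
    hd, by norm_num⟩

theorem Rt.exists_coeff {e : Fin 3 → ℤ} (h : Rt G e) (P : ¬ ∀ x, Bf G e e ∣ Bf G x e) :
    ∃ x c, 2 * Bf G x e = Bf G e e * c ∧ ¬ 2 ∣ c := by
  push Not at P
  obtain ⟨x, hx⟩ := P
  obtain ⟨c, hc⟩ := h.dvd x
  refine ⟨x, c, hc, ?_⟩
  rintro ⟨a, rfl⟩
  exact hx ⟨a, by linarith⟩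

theorem frame_one (hG : G.IsSymm) (hpos : PosDefM G) {e1 e2 e3 : Fin 3 → ℤ} (h : Orth3 G e1 e2 e3)
    (P1 : ¬ ∀ x, Bf G e1 e1 ∣ Bf G x e1) (P2 : ∀ x, Bf G e2 e2 ∣ Bf G x e2)
    (P3 : ∀ x, Bf G e3 e3 ∣ Bf G x e3) : False := by
  obtain ⟨x, c1, hc, hodd⟩ := h.r1.exists_coeff P1
  obtain ⟨b, hb⟩ := P2 x
  obtain ⟨c, hc'⟩ := P3 x
  exact h.r1.no_single x (h.dec hG hpos x (c1 := c1) (c2 := 2 * b) (c3 := 2 * c) hc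
      (by rw [hb]; ring) (by rw [hc']; ring)) hodd ⟨_, rfl⟩ ⟨_, rfl⟩

theorem det_half {e1 e2 e3 y : Fin 3 → ℤ} {b : ℤ} (hy : (2 : ℤ) • y = e1 + e2 + b • e3) :
    (Matrix.of ![e1, e2, e3]).det = 2 * (Matrix.of ![y, e2, e3]).det := by
  have : ∀ i, e1 i = 2 * y i - e2 i - b * e3 i := by
    intro i
    have := congrFun hy i
    simp only [Pi.smul_apply, Pi.add_apply, smul_eq_mul] at this
    linarith
  rw [Matrix.det_fin_three, Matrix.det_fin_three]
  simp [this]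
  ring

theorem frame_two (hG : G.IsSymm) (hpos : PosDefM G) {e1 e2 e3 : Fin 3 → ℤ} (h : Orth3 G e1 e2 e3)
    (P1 : ¬ ∀ x, Bf G e1 e1 ∣ Bf G x e1) (P2 : ¬ ∀ x, Bf G e2 e2 ∣ Bf G x e2)
    (P3 : ∀ x, Bf G e3 e3 ∣ Bf G x e3) :
    ∃ d1 d2, Frame G e1 e2 e3 2 2 1 d1 d2 (Bf G e3 e3) := by
  obtain ⟨x, c1, hc, hodd⟩ := h.r1.exists_coeff P1
  obtain ⟨x', c2', hc', hodd'⟩ := h.r2.exists_coeff P2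
  obtain ⟨d1, hd1⟩ := even_norm hc hodd
  obtain ⟨d2, hd2⟩ := even_norm hc' hodd'
  obtain ⟨c2, hc2⟩ := h.r2.dvd x
  obtain ⟨c3, hc3⟩ := P3 x
  have hx := h.dec hG hpos x (c1 := c1) (c2 := c2) (c3 := 2 * c3) hc hc2 (by rw [hc3]; ring)
  have ho2 : ¬ 2 ∣ c2 := fun h2 => h.r1.no_single x hx hodd h2 ⟨_, rfl⟩
  obtain ⟨a1, rfl⟩ : ∃ a, c1 = 2 * a + 1 := ⟨c1 / 2, by omega⟩
  obtain ⟨a2, rfl⟩ : ∃ a, c2 = 2 * a + 1 := ⟨c2 / 2, by omega⟩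
  obtain ⟨y, hy⟩ : ∃ y : Fin 3 → ℤ, (2 : ℤ) • y = e1 + e2 := by
    refine ⟨x - a1 • e1 - a2 • e2 - c3 • e3, ?_⟩
    simp only [smul_sub, hx]
    module
  have hb : (Matrix.of ![y, e2, e3]).det ^ 2 = 1 := by
    refine basis_det fun z => ?_
    obtain ⟨b1, hb1⟩ := h.r1.dvd z
    obtain ⟨b2, hb2⟩ := h.r2.dvd z
    obtain ⟨b3, hb3⟩ := P3 z
    have hz := h.dec hG hpos z (c3 := 2 * b3) hb1 hb2 (by rw [hb3]; ring)
    have i1 : ¬ 2 ∣ b1 → 2 ∣ b2 → False := fun h1 h2 => h.r1.no_single z hz h1 h2 ⟨_, rfl⟩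
    have i2 : ¬ 2 ∣ b2 → 2 ∣ b1 → False := fun h1 h2 =>
      h.r2.no_single z (hz.trans (by rw [add_comm (b1 • e1)])) h1 h2 ⟨_, rfl⟩
    obtain ⟨m, hm⟩ : (2 : ℤ) ∣ b2 - b1 := par2 i1 i2
    refine ⟨b1, m, b3, two_smul_inj ?_⟩
    rw [hz, smul_add, smul_add, smul_comm (2 : ℤ) b1 y, hy]
    have : b2 = b1 + 2 * m := by linarith
    rw [this]
    module
  have hd := gram_det hG h.o12 h.o13 h.o23
  rw [det_half (y := y) (b := 0) (by rw [hy]; simp), mul_pow, hb, hd1, hd2] at hd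
  have p1 := hpos _ h.r1.ne
  have p2 := hpos _ h.r2.ne
  refine ⟨d1, d2, h.r1.ne, h.r2.ne, h.r3.ne, h.o12, h.o13, h.o23, hd1, hd2, by ring,
    by linarith, by linarith, hpos _ h.r3.ne, Or.inr rfl, Or.inr rfl, Or.inl rfl,
    h.r1.half_dvd hd1, h.r2.half_dvd hd2, P3, by linarith, by norm_num⟩

theorem frame_three_odd (hG : G.IsSymm) (hpos : PosDefM G) (hsf : ¬ (4 : ℤ) ∣ G.det)
    {e1 e2 e3 : Fin 3 → ℤ} (h : Orth3 G e1 e2 e3)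
    {x : Fin 3 → ℤ} {c1 c2 c3 : ℤ} (h1 : 2 * Bf G x e1 = Bf G e1 e1 * c1)
    (h2 : 2 * Bf G x e2 = Bf G e2 e2 * c2) (h3 : 2 * Bf G x e3 = Bf G e3 e3 * c3)
    (i1 : ¬ 2 ∣ c1) (i2 : ¬ 2 ∣ c2) (i3 : ¬ 2 ∣ c3) : False := by
  obtain ⟨d1, hd1⟩ := even_norm h1 i1
  obtain ⟨d2, hd2⟩ := even_norm h2 i2
  obtain ⟨d3, hd3⟩ := even_norm h3 i3
  have hx := h.dec hG hpos x h1 h2 h3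
  obtain ⟨a1, rfl⟩ : ∃ a, c1 = 2 * a + 1 := ⟨c1 / 2, by omega⟩
  obtain ⟨a2, rfl⟩ : ∃ a, c2 = 2 * a + 1 := ⟨c2 / 2, by omega⟩
  obtain ⟨a3, rfl⟩ : ∃ a, c3 = 2 * a + 1 := ⟨c3 / 2, by omega⟩
  obtain ⟨y, hy⟩ : ∃ y : Fin 3 → ℤ, (2 : ℤ) • y = e1 + e2 + e3 := by
    refine ⟨x - a1 • e1 - a2 • e2 - a3 • e3, ?_⟩
    simp only [smul_sub, hx]
    module
  have hb : (Matrix.of ![y, e2, e3]).det ^ 2 = 1 := by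
    refine basis_det fun z => ?_
    obtain ⟨b1, hb1⟩ := h.r1.dvd z
    obtain ⟨b2, hb2⟩ := h.r2.dvd z
    obtain ⟨b3, hb3⟩ := h.r3.dvd z
    have hz := h.dec hG hpos z hb1 hb2 hb3
    have hz' : (2 : ℤ) • (z - y) = (b1 - 1) • e1 + (b2 - 1) • e2 + (b3 - 1) • e3 := by
      rw [smul_sub, hz, hy]
      module
    have j1 : ¬ 2 ∣ b1 → 2 ∣ b2 → 2 ∣ b3 → False := fun h1 h2 h3 => h.r1.no_single z hz h1 h2 h3
    have j2 : ¬ 2 ∣ b2 → 2 ∣ b1 → 2 ∣ b3 → False := fun h1 h2 h3 =>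
      h.r2.no_single z (hz.trans (by rw [add_comm (b1 • e1)])) h1 h2 h3
    have j3 : ¬ 2 ∣ b3 → 2 ∣ b1 → 2 ∣ b2 → False := fun h1 h2 h3 =>
      h.r3.no_single (e2 := e1) (e3 := e2) z (hz.trans (by abel)) h1 h2 h3
    have k1 : ¬ 2 ∣ b1 - 1 → 2 ∣ b2 - 1 → 2 ∣ b3 - 1 → False := fun h1 h2 h3 =>
      h.r1.no_single _ hz' h1 h2 h3
    have k2 : ¬ 2 ∣ b2 - 1 → 2 ∣ b1 - 1 → 2 ∣ b3 - 1 → False := fun h1 h2 h3 =>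
      h.r2.no_single _ (hz'.trans (by rw [add_comm ((b1 - 1) • e1)])) h1 h2 h3
    have k3 : ¬ 2 ∣ b3 - 1 → 2 ∣ b1 - 1 → 2 ∣ b2 - 1 → False := fun h1 h2 h3 =>
      h.r3.no_single (e2 := e1) (e3 := e2) _ (hz'.trans (by abel)) h1 h2 h3
    obtain ⟨⟨m, hm⟩, m', hm'⟩ := par6 j1 j2 j3 k1 k2 k3
    refine ⟨b1, m, m', two_smul_inj ?_⟩
    rw [hz, smul_add, smul_add, smul_comm (2 : ℤ) b1 y, hy]
    have e : b2 = b1 + 2 * m := by linarith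
    have e' : b3 = b1 + 2 * m' := by linarith
    rw [e, e']
    module
  have hd := gram_det hG h.o12 h.o13 h.o23
  rw [det_half (y := y) (b := 1) (by rw [hy]; simp), mul_pow, hb, hd1, hd2, hd3] at hd
  have hD : G.det = 2 * (d1 * d2 * d3) := by linarith
  have o1 : ¬ 2 ∣ d1 := by
    rintro ⟨t, rfl⟩; exact hsf ⟨t * d2 * d3, by rw [hD]; ring⟩
  have o2 : ¬ 2 ∣ d2 := by
    rintro ⟨t, rfl⟩; exact hsf ⟨d1 * t * d3, by rw [hD]; ring⟩
  have o3 : ¬ 2 ∣ d3 := by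
    rintro ⟨t, rfl⟩; exact hsf ⟨d1 * d2 * t, by rw [hD]; ring⟩
  have hyy := congrArg (fun w => Bf G w w) hy
  simp only [Bf_add_left, Bf_add_right, Bf_smul_left, Bf_smul_right, Bf_comm hG e2 e1,
    Bf_comm hG e3 e1, Bf_comm hG e3 e2, h.o12, h.o13, h.o23, hd1, hd2, hd3] at hyy
  omega

theorem frame_three_even (hG : G.IsSymm) (hpos : PosDefM G) (hsf : ¬ (4 : ℤ) ∣ G.det)
    {e1 e2 e3 : Fin 3 → ℤ} (h : Orth3 G e1 e2 e3) {y z : Fin 3 → ℤ}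
    (hy : (2 : ℤ) • y = e1 + e2) (hz : (2 : ℤ) • z = e2 + e3)
    (hno : ∀ (x : Fin 3 → ℤ) (c1 c2 c3 : ℤ), 2 * Bf G x e1 = Bf G e1 e1 * c1 →
      2 * Bf G x e2 = Bf G e2 e2 * c2 → 2 * Bf G x e3 = Bf G e3 e3 * c3 → 2 ∣ c1 + c2 + c3) :
    False := by
  have hb : (Matrix.of ![y, z, e3]).det ^ 2 = 1 := by
    refine basis_det fun x => ?_
    obtain ⟨b1, hb1⟩ := h.r1.dvd x
    obtain ⟨b2, hb2⟩ := h.r2.dvd x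
    obtain ⟨b3, hb3⟩ := h.r3.dvd x
    have hx := h.dec hG hpos x hb1 hb2 hb3
    obtain ⟨m, hm⟩ := hno x b1 b2 b3 hb1 hb2 hb3
    refine ⟨b1, b2 - b1, m - b2, two_smul_inj ?_⟩
    rw [hx, smul_add, smul_add, smul_comm (2 : ℤ) b1 y, hy, smul_comm (2 : ℤ) (b2 - b1) z, hz]
    have e' : b3 = 2 * m - b1 - b2 := by linarith
    rw [e']
    module
  have q1 : (Matrix.of ![e1, e2, e3]).det = 4 * (Matrix.of ![y, z, e3]).det := by
    have f2 : ∀ i, e2 i = 2 * z i - e3 i := by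
      intro i
      have := congrFun hz i
      simp only [Pi.smul_apply, Pi.add_apply, smul_eq_mul] at this
      linarith
    have f1 : ∀ i, e1 i = 2 * y i - (2 * z i - e3 i) := by
      intro i
      have := congrFun hy i
      simp only [Pi.smul_apply, Pi.add_apply, smul_eq_mul] at this
      rw [f2 i] at this
      linarith
    rw [Matrix.det_fin_three, Matrix.det_fin_three]
    simp [f1, f2]
    ring
  have hd := gram_det hG h.o12 h.o13 h.o23
  rw [q1, mul_pow, hb] at hd
  have m2 : Bf G e2 e2 = 4 * Bf G y z := by
    have : Bf G ((2 : ℤ) • y) ((2 : ℤ) • z) = Bf G (e1 + e2) (e2 + e3) := by rw [hy, hz]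
    simp only [Bf_add_left, Bf_add_right, Bf_smul_left, Bf_smul_right, h.o12, h.o13, h.o23] at this
    linarith
  have m1 : Bf G e1 e1 = 4 * (Bf G y y - Bf G y z) := by
    have : Bf G ((2 : ℤ) • y) ((2 : ℤ) • y) = Bf G (e1 + e2) (e1 + e2) := by rw [hy]
    simp only [Bf_add_left, Bf_add_right, Bf_smul_left, Bf_smul_right, Bf_comm hG e2 e1, h.o12] at this
    linarith
  have m3 : Bf G e3 e3 = 4 * (Bf G z z - Bf G y z) := by
    have : Bf G ((2 : ℤ) • z) ((2 : ℤ) • z) = Bf G (e2 + e3) (e2 + e3) := by rw [hz]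
    simp only [Bf_add_left, Bf_add_right, Bf_smul_left, Bf_smul_right, Bf_comm hG e3 e2, h.o23] at this
    linarith
  rw [m1, m2, m3] at hd
  exact hsf ⟨(Bf G y y - Bf G y z) * Bf G y z * (Bf G z z - Bf G y z), by linarith⟩

set_option maxHeartbeats 1000000 in
theorem frame_three (hG : G.IsSymm) (hpos : PosDefM G) (hsf : ¬ (4 : ℤ) ∣ G.det)
    {e1 e2 e3 : Fin 3 → ℤ} (h : Orth3 G e1 e2 e3)
    (P1 : ¬ ∀ x, Bf G e1 e1 ∣ Bf G x e1) (P2 : ¬ ∀ x, Bf G e2 e2 ∣ Bf G x e2)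
    (P3 : ¬ ∀ x, Bf G e3 e3 ∣ Bf G x e3) : False := by
  have hno : ∀ (x : Fin 3 → ℤ) (c1 c2 c3 : ℤ), 2 * Bf G x e1 = Bf G e1 e1 * c1 →
      2 * Bf G x e2 = Bf G e2 e2 * c2 → 2 * Bf G x e3 = Bf G e3 e3 * c3 → 2 ∣ c1 + c2 + c3 := by
    intro x c1 c2 c3 h1 h2 h3
    have hx := h.dec hG hpos x h1 h2 h3
    have j1 : ¬ 2 ∣ c1 → 2 ∣ c2 → 2 ∣ c3 → False := fun h1 h2 h3 => h.r1.no_single x hx h1 h2 h3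
    have j2 : ¬ 2 ∣ c2 → 2 ∣ c1 → 2 ∣ c3 → False := fun h1 h2 h3 =>
      h.r2.no_single x (hx.trans (by rw [add_comm (c1 • e1)])) h1 h2 h3
    have j3 : ¬ 2 ∣ c3 → 2 ∣ c1 → 2 ∣ c2 → False := fun h1 h2 h3 =>
      h.r3.no_single (e2 := e1) (e3 := e2) x (hx.trans (by abel)) h1 h2 h3
    have j4 : ¬ 2 ∣ c1 → ¬ 2 ∣ c2 → ¬ 2 ∣ c3 → False := fun i1 i2 i3 =>
      frame_three_odd hG hpos hsf h h1 h2 h3 i1 i2 i3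
    exact par3 j1 j2 j3 j4
  have key : ∀ x : Fin 3 → ℤ, ∃ c1 c2 c3 : ℤ, (2 : ℤ) • x = c1 • e1 + c2 • e2 + c3 • e3 ∧
      2 ∣ c1 + c2 + c3 ∧ 2 * Bf G x e1 = Bf G e1 e1 * c1 ∧
      2 * Bf G x e2 = Bf G e2 e2 * c2 ∧ 2 * Bf G x e3 = Bf G e3 e3 * c3 := by
    intro x
    obtain ⟨b1, hb1⟩ := h.r1.dvd x
    obtain ⟨b2, hb2⟩ := h.r2.dvd x
    obtain ⟨b3, hb3⟩ := h.r3.dvd x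
    exact ⟨b1, b2, b3, h.dec hG hpos x hb1 hb2 hb3, hno x b1 b2 b3 hb1 hb2 hb3, hb1, hb2, hb3⟩
  have t : ∀ (a b c : Fin 3 → ℤ) (x : Fin 3 → ℤ) (c1 c2 c3 : ℤ),
      (2 : ℤ) • x = c1 • a + c2 • b + c3 • c → ¬ 2 ∣ c1 → ¬ 2 ∣ c2 → 2 ∣ c3 →
      ∃ y : Fin 3 → ℤ, (2 : ℤ) • y = a + b := by
    intro a b c x c1 c2 c3 hx i1 i2 i3
    obtain ⟨a1, rfl⟩ : ∃ a, c1 = 2 * a + 1 := ⟨c1 / 2, by omega⟩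
    obtain ⟨a2, rfl⟩ : ∃ a, c2 = 2 * a + 1 := ⟨c2 / 2, by omega⟩
    obtain ⟨a3, rfl⟩ := i3
    refine ⟨x - a1 • a - a2 • b - a3 • c, ?_⟩
    simp only [smul_sub, hx]
    module
  have odd_of : ∀ {e x : Fin 3 → ℤ} {c c' : ℤ}, Rt G e → 2 * Bf G x e = Bf G e e * c →
      2 * Bf G x e = Bf G e e * c' → c = c' := by
    intro e x c c' he h1 h2
    have := (hpos e he.ne).ne'
    exact mul_left_cancel₀ this (h1.symm.trans h2)
  have T1 : (∃ y : Fin 3 → ℤ, (2 : ℤ) • y = e1 + e2) ∨ ∃ y : Fin 3 → ℤ, (2 : ℤ) • y = e1 + e3 := by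
    obtain ⟨x, c, hc, ho⟩ := h.r1.exists_coeff P1
    obtain ⟨c1, c2, c3, hx, hs, g1, -, -⟩ := key x
    have := odd_of h.r1 hc g1
    subst this
    by_cases h2 : 2 ∣ c2
    · exact Or.inr (t e1 e3 e2 x c c3 c2 (hx.trans (by abel)) ho (by omega) h2)
    · exact Or.inl (t e1 e2 e3 x c c2 c3 hx ho h2 (by omega))
  have T2 : (∃ y : Fin 3 → ℤ, (2 : ℤ) • y = e1 + e2) ∨ ∃ y : Fin 3 → ℤ, (2 : ℤ) • y = e2 + e3 := by
    obtain ⟨x, c, hc, ho⟩ := h.r2.exists_coeff P2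
    obtain ⟨c1, c2, c3, hx, hs, -, g1, -⟩ := key x
    have := odd_of h.r2 hc g1
    subst this
    by_cases h2 : 2 ∣ c1
    · exact Or.inr (t e2 e3 e1 x c c3 c1 (hx.trans (by abel)) ho (by omega) h2)
    · exact Or.inl (t e1 e2 e3 x c1 c c3 hx h2 ho (by omega))
  have T3 : (∃ y : Fin 3 → ℤ, (2 : ℤ) • y = e1 + e3) ∨ ∃ y : Fin 3 → ℤ, (2 : ℤ) • y = e2 + e3 := by
    obtain ⟨x, c, hc, ho⟩ := h.r3.exists_coeff P3
    obtain ⟨c1, c2, c3, hx, hs, -, -, g1⟩ := key x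
    have := odd_of h.r3 hc g1
    subst this
    by_cases h2 : 2 ∣ c1
    · exact Or.inr (t e2 e3 e1 x c2 c c1 (hx.trans (by abel)) (by omega) ho h2)
    · exact Or.inl (t e1 e3 e2 x c1 c c2 (hx.trans (by abel)) h2 ho (by omega))
  have S1 : (∃ y : Fin 3 → ℤ, (2 : ℤ) • y = e1 + e2) → (∃ y : Fin 3 → ℤ, (2 : ℤ) • y = e1 + e3) →
      ∃ y : Fin 3 → ℤ, (2 : ℤ) • y = e2 + e3 := by
    rintro ⟨y, hy⟩ ⟨z, hz⟩
    exact ⟨y + z - e1, by rw [smul_sub, smul_add, hy, hz]; module⟩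
  have S2 : (∃ y : Fin 3 → ℤ, (2 : ℤ) • y = e1 + e3) → (∃ y : Fin 3 → ℤ, (2 : ℤ) • y = e2 + e3) →
      ∃ y : Fin 3 → ℤ, (2 : ℤ) • y = e1 + e2 := by
    rintro ⟨y, hy⟩ ⟨z, hz⟩
    exact ⟨y + z - e3, by rw [smul_sub, smul_add, hy, hz]; module⟩
  obtain ⟨⟨y, hy⟩, z, hz⟩ : (∃ y : Fin 3 → ℤ, (2 : ℤ) • y = e1 + e2) ∧
      ∃ y : Fin 3 → ℤ, (2 : ℤ) • y = e2 + e3 := by tauto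
  exact frame_three_even hG hpos hsf h hy hz hno

theorem exists_frame (hG : G.IsSymm) (hpos : PosDefM G) (hr : ReflectiveM G)
    (hsf : ¬ (4 : ℤ) ∣ G.det) :
    ∃ e1 e2 e3 k1 k2 k3 d1 d2 d3, Frame G e1 e2 e3 k1 k2 k3 d1 d2 d3 := by
  obtain ⟨e1, e2, e3, r1, r2, r3, o12, o13, o23⟩ := exists_orth_triple hG hpos hr
  have h : Orth3 G e1 e2 e3 := ⟨r1, r2, r3, o12, o13, o23⟩
  by_cases P1 : ∀ x, Bf G e1 e1 ∣ Bf G x e1 <;> by_cases P2 : ∀ x, Bf G e2 e2 ∣ Bf G x e2 <;>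
    by_cases P3 : ∀ x, Bf G e3 e3 ∣ Bf G x e3
  · exact ⟨_, _, _, _, _, _, _, _, _, frame_zero hG hpos h P1 P2 P3⟩
  · exact (frame_one hG hpos ((h.swap23 hG).swap12 hG) P3 P1 P2).elim
  · exact (frame_one hG hpos (h.swap12 hG) P2 P1 P3).elim
  · obtain ⟨d1, d2, hF⟩ := frame_two hG hpos ((h.swap12 hG).swap23 hG) P2 P3 P1
    exact ⟨_, _, _, _, _, _, _, _, _, hF⟩
  · exact (frame_one hG hpos h P1 P2 P3).elim
  · obtain ⟨d1, d2, hF⟩ := frame_two hG hpos (h.swap23 hG) P1 P3 P2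
    exact ⟨_, _, _, _, _, _, _, _, _, hF⟩
  · obtain ⟨d1, d2, hF⟩ := frame_two hG hpos h P1 P2 P3
    exact ⟨_, _, _, _, _, _, _, _, _, hF⟩
  · exact (frame_three hG hpos hsf h P1 P2 P3).elim

end FrameInvariants

section PrimeChoice

theorem prod_ge_primorial {T : Finset ℕ} (hT : ∀ p ∈ T, p.Prime) (hc : 10 ≤ T.card) :
    6469693230 ≤ ∏ p ∈ T, p := by
  set F : Finset ℕ := {2, 3, 5, 7, 11, 13, 17, 19, 23, 29} with hF
  have hFp : ∏ p ∈ F, p = 6469693230 := by rw [hF]; decide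
  have hFc : F.card = 10 := by rw [hF]; decide
  have hbig : ∀ p ∈ T \ F, 29 ≤ p := by
    intro p hp
    rw [Finset.mem_sdiff] at hp
    by_contra hlt
    push Not at hlt
    have := hT p hp.1
    apply hp.2
    rw [hF]
    interval_cases p <;> first | decide | (exfalso; revert this; decide)
  have hsmall : ∀ p ∈ F \ T, p ≤ 29 := by
    intro p hp
    rw [Finset.mem_sdiff] at hp
    have : ∀ p ∈ F, p ≤ 29 := by rw [hF]; decide
    exact this p hp.1
  have hcard : (F \ T).card ≤ (T \ F).card := by
    have h1 := Finset.card_sdiff_add_card_inter F T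
    have h2 := Finset.card_sdiff_add_card_inter T F
    rw [Finset.inter_comm] at h2
    omega
  have h1 : ∏ p ∈ F \ T, p ≤ 29 ^ (F \ T).card := Finset.prod_le_pow_card _ _ _ hsmall
  have h2 : 29 ^ (T \ F).card ≤ ∏ p ∈ T \ F, p := Finset.pow_card_le_prod _ _ _ hbig
  have h3 : 29 ^ (F \ T).card ≤ 29 ^ (T \ F).card := Nat.pow_le_pow_right (by norm_num) hcard
  have h4 := Finset.prod_inter_mul_prod_sdiff F T (fun p => p)
  have h5 := Finset.prod_inter_mul_prod_sdiff T F (fun p => p)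
  rw [← hFp, ← h4, ← h5, Finset.inter_comm T F]
  exact Nat.mul_le_mul_left _ (h1.trans (h3.trans h2))

/-- Product of the primes in `[7, n)`. -/
def midPrimorial (n : ℕ) : ℕ := ∏ p ∈ (Finset.range n).filter (fun p => p.Prime ∧ 7 ≤ p), p

theorem prod_mono_nat {S T : Finset ℕ} (h : S ⊆ T) (hT : ∀ p ∈ T, p.Prime) :
    ∏ p ∈ S, p ≤ ∏ p ∈ T, p :=
  Finset.prod_le_prod_of_subset_of_one_le' h (fun i hi _ => (hT i hi).one_le)

theorem midPrimorial_growth (n : ℕ) (hn : 41 ≤ n) : 4 * n ^ 6 < midPrimorial n := by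
  induction n using Nat.strong_induction_on with
  | _ n ih =>
    have hmem : ∀ p ∈ (Finset.range n).filter (fun p => p.Prime ∧ 7 ≤ p), p.Prime :=
      fun p hp => (Finset.mem_filter.mp hp).2.1
    rcases le_or_gt n 61 with h1 | h1
    · have h : ∏ p ∈ ({7, 11, 13, 17, 19, 23, 29, 31, 37} : Finset ℕ), p ≤ midPrimorial n := by
        refine prod_mono_nat ?_ hmem
        intro p hp
        rw [Finset.mem_filter, Finset.mem_range]
        simp only [Finset.mem_insert, Finset.mem_singleton] at hp
        rcases hp with h | h | h | h | h | h | h | h | h <;> subst h <;>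
          exact ⟨by omega, by norm_num, by norm_num⟩
      have h2 : 4 * n ^ 6 ≤ 4 * 61 ^ 6 := Nat.mul_le_mul_left _ (Nat.pow_le_pow_left h1 6)
      refine lt_of_le_of_lt h2 (lt_of_lt_of_le ?_ h)
      decide
    · rcases le_or_gt n 130 with h3 | h3
      · have h : ∏ p ∈ ({7, 11, 13, 17, 19, 23, 29, 31, 37, 41, 43} : Finset ℕ), p ≤
            midPrimorial n := by
          refine prod_mono_nat ?_ hmem
          intro p hp
          rw [Finset.mem_filter, Finset.mem_range]
          simp only [Finset.mem_insert, Finset.mem_singleton] at hp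
          rcases hp with h | h | h | h | h | h | h | h | h | h | h <;> subst h <;>
            exact ⟨by omega, by norm_num, by norm_num⟩
        have h2 : 4 * n ^ 6 ≤ 4 * 130 ^ 6 := Nat.mul_le_mul_left _ (Nat.pow_le_pow_left h3 6)
        refine lt_of_le_of_lt h2 (lt_of_lt_of_le ?_ h)
        decide
      · obtain ⟨p, hp, hk, hk2⟩ := Nat.exists_prime_lt_and_le_two_mul ((n - 1) / 2) (by omega)
        have hpn : p < n := by omega
        have hpi := ih p hpn (by omega)
        have hstep : midPrimorial p * p ≤ midPrimorial n := by
          have hnot : p ∉ (Finset.range p).filter (fun p => p.Prime ∧ 7 ≤ p) := by simp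
          have : midPrimorial p * p =
              ∏ x ∈ insert p ((Finset.range p).filter (fun p => p.Prime ∧ 7 ≤ p)), x := by
            rw [Finset.prod_insert hnot, midPrimorial, mul_comm]
          rw [this]
          refine prod_mono_nat ?_ hmem
          intro x hx
          rw [Finset.mem_insert, Finset.mem_filter, Finset.mem_range] at hx
          rw [Finset.mem_filter, Finset.mem_range]
          rcases hx with rfl | hx
          · exact ⟨hpn, hp, by omega⟩
          · exact ⟨by omega, hx.2⟩
        have hn2 : n ^ 6 ≤ (2 * p) ^ 6 := Nat.pow_le_pow_left (by omega) 6
        have hp64 : 64 ≤ p := by omega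
        have h5 : 4 * p ^ 6 * 64 ≤ 4 * p ^ 6 * p := Nat.mul_le_mul_left _ hp64
        have h6 : 4 * p ^ 6 * p < midPrimorial p * p :=
          Nat.mul_lt_mul_of_pos_right hpi (by omega)
        calc 4 * n ^ 6 ≤ 4 * (2 * p) ^ 6 := Nat.mul_le_mul_left _ hn2
          _ = 4 * p ^ 6 * 64 := by ring
          _ < _ := lt_of_le_of_lt h5 (lt_of_lt_of_le h6 hstep)

theorem exists_ell {T : Finset ℕ} (hT : ∀ p ∈ T, p.Prime) (hc : 10 ≤ T.card) :
    ∃ l : ℕ, l.Prime ∧ 7 ≤ l ∧ l ∉ T ∧ 4 * l ^ 6 < ∏ p ∈ T, p := by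
  have hex : ∃ l : ℕ, l.Prime ∧ 7 ≤ l ∧ l ∉ T := by
    obtain ⟨l, hl, hp⟩ := Nat.exists_infinite_primes (∑ p ∈ T, p + 7)
    refine ⟨l, hp, by omega, fun hmem => ?_⟩
    have : l ≤ ∑ p ∈ T, p := Finset.single_le_sum (f := fun p : ℕ => p) (fun i _ => Nat.zero_le i) hmem
    omega
  classical
  obtain ⟨hp, h7, hnot⟩ := Nat.find_spec hex
  have hmin := fun m => Nat.find_min hex (m := m)
  set l := Nat.find hex with hl
  refine ⟨l, hp, h7, hnot, ?_⟩
  have hsub : ∀ p, p < l → p.Prime → 7 ≤ p → p ∈ T := by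
    intro p h1 h2 h3
    by_contra h4
    exact hmin p h1 ⟨h2, h3, h4⟩
  clear_value l
  rcases le_or_gt l 31 with h1 | h1
  · have := prod_ge_primorial hT hc
    have h2 : 4 * l ^ 6 ≤ 4 * 31 ^ 6 := Nat.mul_le_mul_left _ (Nat.pow_le_pow_left h1 6)
    refine lt_of_le_of_lt h2 (lt_of_lt_of_le ?_ this)
    norm_num
  · rcases lt_or_ge l 41 with h2 | h2
    · have hl37 : l ≤ 37 := by
        by_contra h
        have : l = 38 ∨ l = 39 ∨ l = 40 := by omega
        rcases this with rfl | rfl | rfl <;> revert hp <;> norm_num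
      set F : Finset ℕ := {7, 11, 13, 17, 19, 23, 29, 31} with hF
      have hFT : F ⊆ T := by
        intro p hp
        simp only [hF, Finset.mem_insert, Finset.mem_singleton] at hp
        rcases hp with h | h | h | h | h | h | h | h <;> subst h <;>
          exact hsub _ (by omega) (by norm_num) (by norm_num)
      have hFc : F.card = 8 := by rw [hF]; decide
      have h3 : 2 ^ (T \ F).card ≤ ∏ p ∈ T \ F, p :=
        Finset.pow_card_le_prod _ _ _ (fun p hp => (hT p (Finset.mem_sdiff.mp hp).1).two_le)
      have h4 : 2 ≤ (T \ F).card := by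
        rw [Finset.card_sdiff_of_subset hFT]; omega
      have h5 : 2 ^ 2 ≤ 2 ^ (T \ F).card := Nat.pow_le_pow_right (by norm_num) h4
      have h6 : (∏ p ∈ T \ F, p) * ∏ p ∈ F, p = ∏ p ∈ T, p := Finset.prod_sdiff hFT
      have h7 : ∏ p ∈ F, p = 6685349671 := by rw [hF]; decide
      have h8 : 4 * l ^ 6 ≤ 4 * 37 ^ 6 := Nat.mul_le_mul_left _ (Nat.pow_le_pow_left hl37 6)
      rw [← h6, h7]
      refine lt_of_le_of_lt h8 (lt_of_lt_of_le ?_ (Nat.mul_le_mul_right _ (h5.trans h3)))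
      norm_num
    · refine lt_of_lt_of_le (midPrimorial_growth l h2) (prod_mono_nat ?_ hT)
      intro p hp
      rw [Finset.mem_filter, Finset.mem_range] at hp
      exact hsub p hp.1 hp.2.1 hp.2.2

end PrimeChoice

section Isotropic

theorem iso_fix {l : ℕ} [Fact l.Prime] (h7 : 7 ≤ l) {A B C a b : ZMod l} (hA : A ≠ 0) (hC : C ≠ 0)
    (ha : a ≠ 0) (hb : b ≠ 0) (h : A * a ^ 2 + B * b ^ 2 = 0) :
    ∃ x y z : ZMod l, x ≠ 0 ∧ y ≠ 0 ∧ z ≠ 0 ∧ A * x ^ 2 + B * y ^ 2 + C * z ^ 2 = 0 := by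
  have hsm : ∀ n : ℕ, 0 < n → (∀ p, p.Prime → p ∣ n → p < 7) → (n : ZMod l) ≠ 0 := by
    intro n hn hp h0
    rw [ZMod.natCast_eq_zero_iff] at h0
    have := hp l Fact.out h0
    omega
  have h2 : (2 : ZMod l) ≠ 0 := by
    have := hsm 2 (by norm_num) (fun p hp hd => by have := Nat.le_of_dvd (by norm_num) hd; omega)
    exact_mod_cast this
  have h3 : (3 : ZMod l) ≠ 0 := by
    have := hsm 3 (by norm_num) (fun p hp hd => by have := Nat.le_of_dvd (by norm_num) hd; omega)
    exact_mod_cast this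
  have h5 : (5 : ZMod l) ≠ 0 := by
    have := hsm 5 (by norm_num) (fun p hp hd => by have := Nat.le_of_dvd (by norm_num) hd; omega)
    exact_mod_cast this
  have hdiff : ∀ s t : ZMod l, s ≠ t → C * s ≠ C * t := fun s t hst he =>
    hst (mul_left_cancel₀ hC he)
  have d14 : (1 : ZMod l) ≠ 4 := fun h => h3 (by linear_combination -h)
  have d49 : (4 : ZMod l) ≠ 9 := fun h => h5 (by linear_combination -h)
  have d19 : (1 : ZMod l) ≠ 9 := fun h => by
    have : (2 : ZMod l) ^ 3 = 0 := by linear_combination -h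
    exact h2 (pow_eq_zero_iff (by norm_num) |>.mp this)
  have e14 := hdiff _ _ d14
  have e49 := hdiff _ _ d49
  have e19 := hdiff _ _ d19
  obtain ⟨t, ht0, ht1, ht2⟩ : ∃ t : ZMod l, t ≠ 0 ∧ C * t ^ 2 ≠ A ∧ C * t ^ 2 ≠ -A := by
    by_contra hcon
    push Not at hcon
    have c1 := hcon 1 one_ne_zero
    have c2 := hcon 2 h2
    have c3 := hcon 3 h3
    norm_num at c1 c2 c3 e14 e49 e19
    by_cases q1 : C = A <;> by_cases q2 : C * 4 = A <;> by_cases q3 : C * 9 = A <;> grind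
  refine ⟨(C * t ^ 2 - A) * a, (C * t ^ 2 + A) * b, 2 * A * a * t,
    mul_ne_zero (sub_ne_zero.mpr ht1) ha, mul_ne_zero (fun h => ht2 (by linear_combination h)) hb,
    by simp [h2, hA, ha, ht0], ?_⟩
  linear_combination (C * t ^ 2 + A) ^ 2 * h

open Polynomial in
theorem iso_field {l : ℕ} [Fact l.Prime] (h7 : 7 ≤ l) {A B C : ZMod l} (hA : A ≠ 0) (hB : B ≠ 0)
    (hC : C ≠ 0) :
    ∃ x y z : ZMod l, x ≠ 0 ∧ y ≠ 0 ∧ z ≠ 0 ∧ A * x ^ 2 + B * y ^ 2 + C * z ^ 2 = 0 := by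
  have hodd : Fintype.card (ZMod l) % 2 = 1 := by
    rw [ZMod.card]
    rcases (Fact.out : l.Prime).eq_two_or_odd with h | h
    · omega
    · exact h
  have hf : (Polynomial.C A * X ^ 2 : (ZMod l)[X]).degree = 2 := by
    rw [degree_C_mul_X_pow _ hA]; rfl
  have hg : (Polynomial.C B * X ^ 2 + Polynomial.C C : (ZMod l)[X]).degree = 2 := by
    rw [degree_add_C] <;> rw [degree_C_mul_X_pow _ hB]
    · rfl
    · norm_num
  obtain ⟨x, y, hxy⟩ := FiniteField.exists_root_sum_quadratic hf hg hodd
  simp only [eval_mul, eval_C, eval_pow, eval_X, eval_add] at hxy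
  by_cases hx : x = 0
  · have hy : y ≠ 0 := by
      rintro rfl
      apply hC
      simpa [hx] using hxy
    obtain ⟨u, v, w, hu, hv, hw, h⟩ := iso_fix h7 (A := B) (B := C) (C := A) (a := y) (b := 1) hB hA hy
      one_ne_zero (by rw [hx] at hxy; linear_combination hxy)
    exact ⟨w, u, v, hw, hu, hv, by linear_combination h⟩
  · by_cases hy : y = 0
    · obtain ⟨u, v, w, hu, hv, hw, h⟩ := iso_fix h7 (A := A) (B := C) (C := B) (a := x) (b := 1) hA hB
        hx one_ne_zero (by rw [hy] at hxy; linear_combination hxy)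
      exact ⟨u, w, v, hu, hw, hv, by linear_combination h⟩
    · exact ⟨x, y, 1, hx, hy, one_ne_zero, by linear_combination hxy⟩

theorem iso_int {l : ℕ} (hl : l.Prime) (h7 : 7 ≤ l) {A B C : ℤ} (hA : ¬ (l : ℤ) ∣ A)
    (hB : ¬ (l : ℤ) ∣ B) (hC : ¬ (l : ℤ) ∣ C) :
    ∃ x y z : ℤ, ¬ (l : ℤ) ∣ x ∧ ¬ (l : ℤ) ∣ y ∧ ¬ (l : ℤ) ∣ z ∧
      (l : ℤ) ^ 2 ∣ A * x ^ 2 + B * y ^ 2 + C * z ^ 2 := by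
  have : Fact l.Prime := ⟨hl⟩
  simp only [← ZMod.intCast_zmod_eq_zero_iff_dvd] at hA hB hC
  obtain ⟨x, y, z, hx, hy, hz, h⟩ := iso_field h7 hA hB hC
  obtain ⟨x, rfl⟩ := ZMod.intCast_surjective x
  obtain ⟨y, rfl⟩ := ZMod.intCast_surjective y
  obtain ⟨z, rfl⟩ := ZMod.intCast_surjective z
  have h2 : (2 : ZMod l) ≠ 0 := by
    intro h0
    have : ((2 : ℕ) : ZMod l) = 0 := by exact_mod_cast h0
    rw [ZMod.natCast_eq_zero_iff] at this
    have := Nat.le_of_dvd (by norm_num) this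
    omega
  have hQ : ((A * x ^ 2 + B * y ^ 2 + C * z ^ 2 : ℤ) : ZMod l) = 0 := by push_cast; exact h
  rw [ZMod.intCast_zmod_eq_zero_iff_dvd] at hQ
  obtain ⟨k, hk⟩ := hQ
  have hu : (2 * (A : ZMod l) * x) ≠ 0 := mul_ne_zero (mul_ne_zero h2 hA) hx
  obtain ⟨u, hu'⟩ := ZMod.intCast_surjective (-(k : ZMod l) / (2 * (A : ZMod l) * (x : ZMod l)))
  have hk2 : ((k + 2 * A * x * u : ℤ) : ZMod l) = 0 := by
    push_cast
    rw [hu']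
    rw [mul_div_cancel₀ _ hu]
    ring
  rw [ZMod.intCast_zmod_eq_zero_iff_dvd] at hk2
  obtain ⟨m, hm⟩ := hk2
  refine ⟨x + l * u, y, z, ?_, ?_, ?_, m + A * u ^ 2, ?_⟩
  · rw [← ZMod.intCast_zmod_eq_zero_iff_dvd]
    push_cast
    simpa using hx
  · rwa [← ZMod.intCast_zmod_eq_zero_iff_dvd]
  · rwa [← ZMod.intCast_zmod_eq_zero_iff_dvd]
  · linear_combination hk + l * hm

end Isotropic

section NormalForm

variable {G : Matrix (Fin 3) (Fin 3) ℤ}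

theorem gcd_two (a b : ℤ) : ∃ g a' b' p q : ℤ, a = g * a' ∧ b = g * b' ∧ p * a' + q * b' = 1 := by
  by_cases h : (Int.gcd a b) = 0
  · rw [Int.gcd_eq_zero_iff] at h
    exact ⟨0, 1, 0, 1, 0, by rw [h.1]; ring, by rw [h.2]; ring, by ring⟩
  · obtain ⟨a', ha⟩ := Int.gcd_dvd_left a b
    obtain ⟨b', hb⟩ := Int.gcd_dvd_right a b
    have hg : ((Int.gcd a b : ℕ) : ℤ) ≠ 0 := by exact_mod_cast h
    refine ⟨Int.gcd a b, a', b', Int.gcdA a b, Int.gcdB a b, ha, hb, ?_⟩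
    apply mul_left_cancel₀ hg
    have := Int.gcd_eq_gcd_ab a b
    linear_combination (-1 : ℤ) * this - Int.gcdA a b * ha - Int.gcdB a b * hb

theorem prim_complete {f : Fin 3 → ℤ} (hf : PrimVec f) :
    ∃ U : Matrix (Fin 3) (Fin 3) ℤ, U.det = 1 ∧ ∀ i, U i 0 = f i := by
  obtain ⟨g, b', c', p, q, hb, hc, hpq⟩ := gcd_two (f 1) (f 2)
  obtain ⟨w0, w1, w2, hw⟩ : ∃ w0 w1 w2 : ℤ, w0 * f 0 + w1 * f 1 + w2 * f 2 = 1 := prim_bezout hf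
  refine ⟨!![f 0, -(w1 * b' + w2 * c'), 0; f 1, w0 * b', -q; f 2, w0 * c', p], ?_, ?_⟩
  · rw [Matrix.det_fin_three]
    simp
    rw [hb, hc] at *
    linear_combination hw + (f 0 * w0 + g * (w1 * b' + w2 * c')) * hpq
  · intro i
    fin_cases i <;> rfl

/-- The normalised Gram matrix. -/
def NF (a h r s t : ℤ) : Matrix (Fin 3) (Fin 3) ℤ := !![a, h, 0; h, r, s; 0, s, t]

theorem Bf_NF (a h r s t : ℤ) (x y : Fin 3 → ℤ) : Bf (NF a h r s t) x y =
    a * x 0 * y 0 + h * (x 0 * y 1 + x 1 * y 0) + r * x 1 * y 1 + s * (x 1 * y 2 + x 2 * y 1) +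
      t * x 2 * y 2 := by
  simp [Bf, NF, dotProduct, Matrix.mulVec, Fin.sum_univ_three]
  ring

theorem NF_det (a h r s t : ℤ) : (NF a h r s t).det = a * (r * t - s ^ 2) - h ^ 2 * t := by
  rw [Matrix.det_fin_three]
  simp [NF]
  ring

theorem NF_symm (a h r s t : ℤ) : (NF a h r s t).IsSymm := by
  ext i j
  fin_cases i <;> fin_cases j <;> rfl

theorem entry_eq (U : Matrix (Fin 3) (Fin 3) ℤ) (i j : Fin 3) :
    (Uᵀ * G * U) i j = Bf G (fun k => U k i) (fun k => U k j) := by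
  have := gram_apply (G := G) Uᵀ i j
  rw [Matrix.transpose_transpose] at this
  rw [this]
  rfl

theorem exists_NF (hG : G.IsSymm) {f : Fin 3 → ℤ} (hf : PrimVec f) :
    ∃ (U : Matrix (Fin 3) (Fin 3) ℤ) (h r s t : ℤ), U.det = 1 ∧ (∀ i, U i 0 = f i) ∧
      Uᵀ * G * U = NF (Bf G f f) h r s t := by
  obtain ⟨U, hU, hUf⟩ := prim_complete hf
  obtain ⟨g, a', b', p, q, ha, hb, hpq⟩ := gcd_two (Bf G f (fun k => U k 1)) (Bf G f (fun k => U k 2))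
  set W : Matrix (Fin 3) (Fin 3) ℤ := !![1, 0, 0; 0, p, -b'; 0, q, a'] with hW
  have hW1 : W.det = 1 := by
    rw [Matrix.det_fin_three]
    simp [hW]
    linear_combination hpq
  have hc0 : ∀ i, (U * W) i 0 = f i := by
    intro i
    rw [Matrix.mul_apply, Fin.sum_univ_three, ← hUf i]
    simp [hW]
  have hc2 : (fun k => (U * W) k 2) = (-b') • (fun k => U k 1) + a' • (fun k => U k 2) := by
    ext k
    rw [Matrix.mul_apply, Fin.sum_univ_three]
    simp [hW]
    ring
  have hf' : (fun k => (U * W) k 0) = f := funext hc0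
  have e00 : ((U * W)ᵀ * G * (U * W)) 0 0 = Bf G f f := by rw [entry_eq, hf']
  have e02 : ((U * W)ᵀ * G * (U * W)) 0 2 = 0 := by
    rw [entry_eq, hf', hc2, Bf_add_right, Bf_smul_right, Bf_smul_right, ha, hb]
    ring
  have hs : ∀ i j, ((U * W)ᵀ * G * (U * W)) i j = ((U * W)ᵀ * G * (U * W)) j i := by
    intro i j
    rw [entry_eq, entry_eq, Bf_comm hG]
  refine ⟨U * W, ((U * W)ᵀ * G * (U * W)) 0 1, ((U * W)ᵀ * G * (U * W)) 1 1,
    ((U * W)ᵀ * G * (U * W)) 1 2, ((U * W)ᵀ * G * (U * W)) 2 2, by rw [Matrix.det_mul, hU, hW1]; rfl,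
    hc0, ?_⟩
  have e20 := (hs 2 0).trans e02
  ext i j
  fin_cases i <;> fin_cases j <;> simp only [NF]
  · exact e00
  · rfl
  · exact e02
  · exact hs 1 0
  · rfl
  · rfl
  · exact e20
  · exact hs 2 1
  · rfl

theorem Frame.transport {e1 e2 e3 : Fin 3 → ℤ} {k1 k2 k3 d1 d2 d3 : ℤ}
    (h : Frame G e1 e2 e3 k1 k2 k3 d1 d2 d3) {U : Matrix (Fin 3) (Fin 3) ℤ} (hU : U.det = 1) :
    Frame (Uᵀ * G * U) (U.adjugate.mulVec e1) (U.adjugate.mulVec e2) (U.adjugate.mulVec e3)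
      k1 k2 k3 d1 d2 d3 := by
  have hc : ∀ e, U.mulVec (U.adjugate.mulVec e) = e := by
    intro e
    rw [Matrix.mulVec_mulVec, Matrix.mul_adjugate, hU, one_smul, Matrix.one_mulVec]
  have hne : ∀ e, e ≠ 0 → U.adjugate.mulVec e ≠ 0 := by
    intro e he h0
    apply he
    rw [← hc e, h0, Matrix.mulVec_zero]
  refine ⟨hne _ h.ne1, hne _ h.ne2, hne _ h.ne3, ?_, ?_, ?_, ?_, ?_, ?_, h.p1, h.p2, h.p3, h.h1, h.h2,
    h.h3, ?_, ?_, ?_, ?_, h.kk⟩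
  all_goals try simp only [Bf_congr, hc]
  · exact h.o12
  · exact h.o13
  · exact h.o23
  · exact h.n1
  · exact h.n2
  · exact h.n3
  · exact fun x => h.dv1 _
  · exact fun x => h.dv2 _
  · exact fun x => h.dv3 _
  · rw [Matrix.det_mul, Matrix.det_mul, Matrix.det_transpose, hU, h.prod]; ring

theorem local_equiv {G' N : Matrix (Fin 3) (Fin 3) ℤ} (p : ℕ) [Fact p.Prime] {c : ℤ}
    (hc : ¬ (p : ℤ) ∣ c) (h : Nᵀ * G * N = (c ^ 2) • G') (hd : N.det = c ^ 3 ∨ N.det = -c ^ 3) :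
    ∃ S : Matrix (Fin 3) (Fin 3) ℤ_[p], IsUnit S.det ∧
      Sᵀ * G.map (Int.cast : ℤ → ℤ_[p]) * S = G'.map (Int.cast : ℤ → ℤ_[p]) := by
  have hu : IsUnit (c : ℤ_[p]) := by
    rw [PadicInt.isUnit_iff]
    have h1 := PadicInt.norm_le_one (c : ℤ_[p])
    have h2 := (PadicInt.norm_int_lt_one_iff_dvd (p := p) c).not.mpr hc
    exact le_antisymm h1 (not_lt.mp h2)
  obtain ⟨b, hb⟩ := hu.exists_left_inv
  refine ⟨b • N.map (Int.cast : ℤ → ℤ_[p]), ?_, ?_⟩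
  · rw [Matrix.det_smul, Fintype.card_fin]
    have hN : (N.map (Int.cast : ℤ → ℤ_[p])).det = ((N.det : ℤ) : ℤ_[p]) := by
      have := (Int.castRingHom ℤ_[p]).map_det N
      exact this.symm
    have h3 : b ^ 3 * (c : ℤ_[p]) ^ 3 = 1 := by rw [← mul_pow, hb, one_pow]
    rw [hN]
    rcases hd with hd | hd <;> rw [hd] <;> push_cast
    · rw [h3]; exact isUnit_one
    · rw [mul_neg, h3]; exact isUnit_one.neg
  · have h2 : (N.map (Int.cast : ℤ → ℤ_[p]))ᵀ * G.map (Int.cast : ℤ → ℤ_[p]) *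
        N.map (Int.cast : ℤ → ℤ_[p]) = ((c : ℤ_[p]) ^ 2) • G'.map (Int.cast : ℤ → ℤ_[p]) := by
      have := congrArg (fun M : Matrix (Fin 3) (Fin 3) ℤ => M.map (Int.castRingHom ℤ_[p])) h
      simp only [Matrix.map_mul] at this
      rw [Matrix.transpose_map] at this
      refine this.trans ?_
      ext i j
      simp only [Matrix.map_apply, Matrix.smul_apply, smul_eq_mul, eq_intCast]
      push_cast
      rfl
    rw [Matrix.transpose_smul, Matrix.smul_mul, Matrix.smul_mul, Matrix.mul_smul, h2, smul_smul, smul_smul]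
    have : b * b * (c : ℤ_[p]) ^ 2 = 1 := by linear_combination (b * c + 1) * hb
    rw [this, one_smul]

theorem neighbor_genus {U : Matrix (Fin 3) (Fin 3) ℤ} (hU : U.det = 1) {l : ℕ} (hl : l.Prime)
    (h7 : 7 ≤ l) {m h r s t : ℤ} (hh : ¬ (l : ℤ) ∣ h)
    (hN : Uᵀ * G * U = NF ((l : ℤ) ^ 2 * m) h r s t) :
    SameGenusM G (NF m h ((l : ℤ) ^ 2 * r) (l * s) t) := by
  intro p hp
  have key : ∀ N0 : Matrix (Fin 3) (Fin 3) ℤ, (U * N0)ᵀ * G * (U * N0) =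
      N0ᵀ * NF ((l : ℤ) ^ 2 * m) h r s t * N0 := by
    intro N0
    rw [← hN, Matrix.transpose_mul]
    simp only [Matrix.mul_assoc]
  by_cases hpl : p = l
  · subst hpl
    set q : ℤ := 2 * h - p * (m + r) with hq
    set N0 : Matrix (Fin 3) (Fin 3) ℤ := !![m - r, 2 * (h - p * r), -2 * s;
      2 * (h - p * m), p ^ 2 * (r - m), 2 * p * s; 0, 0, q] with hN0
    refine local_equiv (N := U * N0) p (c := q) ?_ ?_ (Or.inr ?_)
    · intro hd
      have h2 : (p : ℤ) ∣ 2 * h := by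
        have : 2 * h = q + p * (m + r) := by rw [hq]; ring
        rw [this]
        exact dvd_add hd ⟨_, rfl⟩
      rcases (Nat.prime_iff_prime_int.mp hl).dvd_or_dvd h2 with h3 | h3
      · have := Int.le_of_dvd (by norm_num) h3
        omega
      · exact hh h3
    · rw [key]
      ext i j
      fin_cases i <;> fin_cases j <;>
        simp [Matrix.mul_apply, Fin.sum_univ_three, NF, hN0, hq] <;> ring
    · rw [Matrix.det_mul, hU, one_mul, Matrix.det_fin_three]
      simp [hN0, hq]
      ring
  · refine local_equiv (N := U * !![1, 0, 0; 0, (l : ℤ) ^ 2, 0; 0, 0, l]) p (c := l) ?_ ?_ (Or.inl ?_)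
    · intro hd
      have : p ∣ l := by exact_mod_cast hd
      exact hpl ((Nat.prime_dvd_prime_iff_eq hp.out hl).mp this)
    · rw [key]
      ext i j
      fin_cases i <;> fin_cases j <;>
        simp [Matrix.mul_apply, Fin.sum_univ_three, NF] <;> ring
    · rw [Matrix.det_mul, hU, one_mul, Matrix.det_fin_three]
      simp
      ring

end NormalForm

section Neighbor

/-- Abstract data relating a lattice and its neighbor at `l`. -/
structure Nb (l : ℤ) (G1 G' : Matrix (Fin 3) (Fin 3) ℤ) (φ ψ : (Fin 3 → ℤ) → (Fin 3 → ℤ)) : Prop where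
  s1 : G1.IsSymm
  s' : G'.IsSymm
  pos1 : PosDefM G1
  det : G'.det = G1.det
  pp : ∀ f g, Bf G1 (φ f) (φ g) = l ^ 2 * Bf G' f g
  adj : ∀ f x, Bf G1 (φ f) x = Bf G' f (ψ x)
  smul : ∀ (c : ℤ) x, ψ (c • x) = c • ψ x
  inv : ∀ x, ψ (φ x) = l ^ 2 • x
  inv' : ∀ x, φ (ψ x) = l ^ 2 • x
  coord : ∀ x, ψ x 1 = x 1

theorem nb_NF {l m h r s t : ℤ} (hpos : PosDefM (NF (l ^ 2 * m) h r s t)) :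
    Nb l (NF (l ^ 2 * m) h r s t) (NF m h (l ^ 2 * r) (l * s) t)
      (fun f => ![f 0, l ^ 2 * f 1, l * f 2]) (fun x => ![l ^ 2 * x 0, x 1, l * x 2]) := by
  refine ⟨NF_symm .., NF_symm .., hpos, ?_, ?_, ?_, ?_, ?_, ?_, fun x => rfl⟩
  · rw [NF_det, NF_det]; ring
  · intro f g
    rw [Bf_NF, Bf_NF]
    simp
    ring
  · intro f g
    rw [Bf_NF, Bf_NF]
    simp
    ring
  · intro c x
    ext i
    fin_cases i <;> simp <;> ring
  · intro x
    ext i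
    fin_cases i <;> simp <;> ring
  · intro x
    ext i
    fin_cases i <;> simp <;> ring

variable {l : ℤ} {G1 G' : Matrix (Fin 3) (Fin 3) ℤ} {φ ψ : (Fin 3 → ℤ) → (Fin 3 → ℤ)}

theorem Nb.phi_ne (hN : Nb l G1 G' φ ψ) (hl : l ≠ 0) {f : Fin 3 → ℤ} (hf : f ≠ 0) : φ f ≠ 0 := by
  intro h0
  have h1 := hN.inv f
  have h2 : ψ 0 = 0 := by simpa using hN.smul 0 0
  rw [h0, h2] at h1
  exact hf ((smul_eq_zero.mp h1.symm).resolve_left (pow_ne_zero 2 hl))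

theorem Nb.psi_ne (hN : Nb l G1 G' φ ψ) (hl : l ≠ 0) {x : Fin 3 → ℤ} (hx : x ≠ 0) : ψ x ≠ 0 := by
  intro h0
  have h1 := hN.pp (ψ x) (ψ x)
  rw [hN.inv'] at h1
  have h2 : Bf G' (ψ x) (ψ x) = 0 := by
    conv_lhs => rw [h0]
    simp [Bf]
  rw [h2, Bf_smul_left, Bf_smul_right] at h1
  have := hN.pos1 x hx
  have hl2 : 0 < l ^ 2 := by positivity
  have : 0 < l ^ 2 * (l ^ 2 * Bf G1 x x) := by positivity
  omega

theorem Nb.pos' (hN : Nb l G1 G' φ ψ) (hl : l ≠ 0) : PosDefM G' := by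
  intro f hf
  have h1 := hN.pos1 _ (hN.phi_ne hl hf)
  rw [hN.pp] at h1
  have hl2 : 0 < l ^ 2 := by positivity
  exact (mul_pos_iff_of_pos_left hl2).mp h1

theorem Frame.nonneg {G : Matrix (Fin 3) (Fin 3) ℤ} {e1 e2 e3 : Fin 3 → ℤ} {k1 k2 k3 d1 d2 d3 : ℤ}
    (hF : Frame G e1 e2 e3 k1 k2 k3 d1 d2 d3) : 0 < k1 ∧ 0 < k2 ∧ 0 < k3 := by
  refine ⟨?_, ?_, ?_⟩
  · rcases hF.h1 with h | h <;> omega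
  · rcases hF.h2 with h | h <;> omega
  · rcases hF.h3 with h | h <;> omega

/-- Expansion of the form in the frame. -/
theorem parseval {G : Matrix (Fin 3) (Fin 3) ℤ} (hG : G.IsSymm) (hpos : PosDefM G)
    {e1 e2 e3 : Fin 3 → ℤ} {k1 k2 k3 d1 d2 d3 : ℤ} (hF : Frame G e1 e2 e3 k1 k2 k3 d1 d2 d3)
    (w : Fin 3 → ℤ) :
    (Bf G e1 e1 * Bf G e2 e2 * Bf G e3 e3) • w = (Bf G w e1 * (Bf G e2 e2 * Bf G e3 e3)) • e1 +
      (Bf G w e2 * (Bf G e1 e1 * Bf G e3 e3)) • e2 + (Bf G w e3 * (Bf G e1 e1 * Bf G e2 e2)) • e3 := by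
  rw [← sub_eq_zero]
  refine orth_zero hG hpos hF.o12 hF.o13 hF.o23 hF.ne1 hF.ne2 hF.ne3 ?_ ?_ ?_
  all_goals
    simp only [Bf_sub_left, Bf_add_left, Bf_smul_left, Bf_comm hG e2 e1, Bf_comm hG e3 e1,
      Bf_comm hG e3 e2, hF.o12, hF.o13, hF.o23]
    ring

theorem Nb.parseval (hN : Nb l G1 G' φ ψ) {e1 e2 e3 : Fin 3 → ℤ} {k1 k2 k3 d1 d2 d3 : ℤ}
    (hF : Frame G1 e1 e2 e3 k1 k2 k3 d1 d2 d3) (f g : Fin 3 → ℤ) :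
    (Bf G1 e1 e1 * Bf G1 e2 e2 * Bf G1 e3 e3) * (l ^ 2 * Bf G' f g) =
      Bf G' f (ψ e1) * Bf G' g (ψ e1) * (Bf G1 e2 e2 * Bf G1 e3 e3) +
      Bf G' f (ψ e2) * Bf G' g (ψ e2) * (Bf G1 e1 e1 * Bf G1 e3 e3) +
      Bf G' f (ψ e3) * Bf G' g (ψ e3) * (Bf G1 e1 e1 * Bf G1 e2 e2) := by
  have h := congrArg (fun y => Bf G1 y (φ g)) (_root_.parseval hN.s1 hN.pos1 hF (φ f))
  simp only [Bf_add_left, Bf_smul_left, Bf_comm hN.s1 e1 (φ g), Bf_comm hN.s1 e2 (φ g),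
    Bf_comm hN.s1 e3 (φ g)] at h
  rw [hN.pp] at h
  simp only [hN.adj] at h
  linear_combination h

theorem dvd_arith {d1 d2 d a b : ℤ} (h1 : 0 < d1) (hc : IsCoprime d1 d2) (ha1 : d1 ∣ a) (ha : d ∣ a)
    (hb2 : d2 ∣ b) (hb : d ∣ b) : d1 * d2 * d ∣ a * b := by
  obtain ⟨g, d1', c', p, q, e1, e2, hpq⟩ := gcd_two d1 d
  have hg : g ≠ 0 := by
    rintro rfl
    rw [zero_mul] at e1
    omega
  obtain ⟨x, hx⟩ := ha1
  obtain ⟨y, hy⟩ := ha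
  have hcx : c' ∣ x := by
    have hxy : d1' * x = c' * y := by
      apply mul_left_cancel₀ hg
      rw [← mul_assoc, ← mul_assoc, ← e1, ← e2, ← hx, ← hy]
    have hco : IsCoprime c' d1' := ⟨q, p, by linarith⟩
    exact hco.dvd_of_dvd_mul_left ⟨y, hxy⟩
  have hA : d1 * c' ∣ a := by
    rw [hx]
    exact mul_dvd_mul_left _ hcx
  have hB : d2 * g ∣ b := by
    have hco : IsCoprime d2 g := (hc.of_isCoprime_of_dvd_left ⟨d1', e1⟩).symm
    exact hco.mul_dvd hb2 ((Dvd.intro _ e2.symm).trans hb)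
  have h := mul_dvd_mul hA hB
  have e : d1 * d2 * d = d1 * c' * (d2 * g) := by linear_combination d1 * d2 * e2
  rw [e]
  exact h

/-- The reduced norm of a root. -/
theorem Rt.reduced {G : Matrix (Fin 3) (Fin 3) ℤ} (hpos : PosDefM G) {f : Fin 3 → ℤ} (hf : Rt G f) :
    ∃ d, 0 < d ∧ Bf G f f ≤ 2 * d ∧ ∀ x, d ∣ Bf G x f := by
  have hp := hpos f hf.ne
  by_cases P : ∀ x, Bf G f f ∣ Bf G x f
  · exact ⟨Bf G f f, hp, by linarith, P⟩
  · obtain ⟨x, c, hc, ho⟩ := hf.exists_coeff P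
    obtain ⟨d, hd⟩ := even_norm hc ho
    exact ⟨d, by linarith, by linarith, hf.half_dvd hd⟩

theorem two_nonzero (hN : Nb l G1 G' φ ψ) (hl : l ≠ 0) {e1 e2 e3 : Fin 3 → ℤ}
    {k1 k2 k3 d1 d2 d3 : ℤ} (hF : Frame G1 e1 e2 e3 k1 k2 k3 d1 d2 d3) (hco : IsCoprime d1 d2)
    {f : Fin 3 → ℤ} (hf : Rt G' f) (b1 : Bf G' f (ψ e1) ≠ 0) (b2 : Bf G' f (ψ e2) ≠ 0) :
    d1 * d2 ≤ l ^ 4 * (k1 * k2) := by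
  obtain ⟨d, hd0, hd2, hdv⟩ := hf.reduced (hN.pos' hl)
  have hdiv : d1 * d2 * d ∣ Bf G' f (ψ e1) * Bf G' f (ψ e2) := by
    refine dvd_arith hF.p1 hco ?_ ?_ ?_ ?_
    · rw [← hN.adj]; exact hF.dv1 _
    · rw [Bf_comm hN.s']; exact hdv _
    · rw [← hN.adj]; exact hF.dv2 _
    · rw [Bf_comm hN.s']; exact hdv _
  have hpv := hN.parseval hF f f
  have hn3 := hN.pos1 _ hF.ne3
  have hn1 := hN.pos1 _ hF.ne1
  have hn2 := hN.pos1 _ hF.ne2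
  have hn' := hN.pos' hl f hf.ne
  have p1 := hF.p1
  have p2 := hF.p2
  obtain ⟨q1, q2, -⟩ := hF.nonneg
  have en1 := hF.n1
  have en2 := hF.n2
  set β1 := Bf G' f (ψ e1)
  set β2 := Bf G' f (ψ e2)
  set β3 := Bf G' f (ψ e3)
  set n1 := Bf G1 e1 e1
  set n2 := Bf G1 e2 e2
  set n3 := Bf G1 e3 e3
  set n' := Bf G' f f
  have hle : |d1 * d2 * d| ≤ |β1 * β2| := 
    Int.le_of_dvd (abs_pos.mpr (mul_ne_zero b1 b2)) ((abs_dvd_abs _ _).mpr hdiv)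
  have hsq : (d1 * d2 * d) ^ 2 ≤ (β1 * β2) ^ 2 := sq_le_sq.mpr hle
  have h1 : β1 ^ 2 * n2 + β2 ^ 2 * n1 ≤ n1 * n2 * (l ^ 2 * n') := by
    have h3 : 0 ≤ β3 * β3 * (n1 * n2) := by have := mul_self_nonneg β3; positivity
    have : (β1 ^ 2 * n2 + β2 ^ 2 * n1) * n3 ≤ (n1 * n2 * (l ^ 2 * n')) * n3 := by linarith
    exact le_of_mul_le_mul_right this hn3
  have h2 : 4 * (β1 * β2) ^ 2 * (n1 * n2) ≤ (n1 * n2 * (l ^ 2 * n')) ^ 2 := by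
    have h0 : 0 ≤ β1 ^ 2 * n2 + β2 ^ 2 * n1 := by positivity
    have h4 := pow_le_pow_left₀ h0 h1 2
    linarith [sq_nonneg (β1 ^ 2 * n2 - β2 ^ 2 * n1)]
  have h3 : 4 * (β1 * β2) ^ 2 ≤ n1 * n2 * (l ^ 4 * n' ^ 2) := by
    have hpos : 0 < n1 * n2 := by positivity
    refine le_of_mul_le_mul_right ?_ hpos
    linarith
  have h4 : n' ^ 2 ≤ 4 * d ^ 2 := by
    have := pow_le_pow_left₀ hn'.le hd2 2
    linarith
  have hl4 : 0 < l ^ 4 := by positivity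
  have h5 : n1 * n2 * (l ^ 4 * n' ^ 2) ≤ n1 * n2 * (l ^ 4 * (4 * d ^ 2)) := by gcongr
  have h6 : (d1 * d2) * (4 * d ^ 2 * (d1 * d2)) ≤ (l ^ 4 * (k1 * k2)) * (4 * d ^ 2 * (d1 * d2)) := by
    rw [en1, en2] at h5 h3
    linarith
  exact le_of_mul_le_mul_right h6 (by positivity)

theorem no_axis {lp : ℕ} (hlp : lp.Prime) (h7 : 7 ≤ lp) (hN : Nb lp G1 G' φ ψ)
    (hD : ¬ (lp : ℤ) ∣ G1.det) {e1 e2 e3 : Fin 3 → ℤ}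
    {k1 k2 k3 d1 d2 d3 : ℤ} (hF : Frame G1 e1 e2 e3 k1 k2 k3 d1 d2 d3) (he : ¬ (lp : ℤ) ∣ e1 1)
    {f : Fin 3 → ℤ} (hf : Rt G' f) (b2 : Bf G' f (ψ e2) = 0) (b3 : Bf G' f (ψ e3) = 0) : False := by
  have hl0 : (lp : ℤ) ≠ 0 := by exact_mod_cast hlp.ne_zero
  have hpr := Nat.prime_iff_prime_int.mp hlp
  have hn1 := hN.pos1 _ hF.ne1
  have hn' := hN.pos' hl0 f hf.ne
  have hpar : Bf G1 e1 e1 • φ f = Bf G' f (ψ e1) • e1 := by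
    rw [← sub_eq_zero]
    refine orth_zero hN.s1 hN.pos1 hF.o12 hF.o13 hF.o23 hF.ne1 hF.ne2 hF.ne3 ?_ ?_ ?_ <;>
      simp only [Bf_sub_left, Bf_smul_left, hN.adj, b2, b3] <;> simp only [← hN.adj, hF.o12, hF.o13] <;>
      ring
  have hpsi := congrArg ψ hpar
  rw [hN.smul, hN.smul, hN.inv, smul_smul] at hpsi
  have hb1 : Bf G' f (ψ e1) ≠ 0 := by
    intro h0
    rw [h0, zero_smul] at hpar
    exact hN.phi_ne hl0 hf.ne ((smul_eq_zero.mp hpar).resolve_left hn1.ne')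
  obtain ⟨k, hk⟩ := prim_smul_parallel hf.prim hb1 hpsi.symm
  have hnorm : k ^ 2 * Bf G' f f = (lp : ℤ) ^ 2 * Bf G1 e1 e1 := by
    have h1 := hN.pp (ψ e1) (ψ e1)
    rw [hN.inv', hk, Bf_smul_left, Bf_smul_left, Bf_smul_right, Bf_smul_right] at h1
    have hl2 : (lp : ℤ) ^ 2 ≠ 0 := pow_ne_zero 2 hl0
    apply mul_left_cancel₀ hl2
    linarith
  have hnk : ¬ (lp : ℤ) ∣ k := by
    intro hd
    apply he
    rw [← hN.coord e1, hk]
    exact Dvd.dvd.mul_right hd _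
  have hn'd : (lp : ℤ) ∣ Bf G' f f := by
    have h1 : (lp : ℤ) ∣ k ^ 2 * Bf G' f f := by
      rw [hnorm, sq, mul_assoc]
      exact ⟨_, rfl⟩
    rcases hpr.dvd_or_dvd h1 with h | h
    · exact absurd (hpr.dvd_of_dvd_pow h) hnk
    · exact h
  have hall : ∀ y, (lp : ℤ) ∣ Bf G' y f := by
    intro y
    rcases hpr.dvd_or_dvd (hn'd.trans (hf.dvd y)) with h | h
    · have := Int.le_of_dvd (by norm_num) h
      omega
    · exact h
  apply hD
  rw [← hN.det]
  refine prim_dvd hf.prim fun i => ?_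
  have hadj : G'.det * f i = (G'.adjugate.mulVec (G'.mulVec f)) i := by
    rw [Matrix.mulVec_mulVec, Matrix.adjugate_mul, Matrix.smul_mulVec, Matrix.one_mulVec]
    rfl
  rw [hadj, Matrix.mulVec, dotProduct]
  refine Finset.dvd_sum fun j _ => Dvd.dvd.mul_left ?_ _
  have := hall (Pi.single j 1)
  simpa [Bf] using this

theorem core {lp : ℕ} (hlp : lp.Prime) (h7 : 7 ≤ lp) (hN : Nb lp G1 G' φ ψ)
    (hD : ¬ (lp : ℤ) ∣ G1.det) {e1 e2 e3 : Fin 3 → ℤ}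
    {k1 k2 k3 d1 d2 d3 : ℤ} (hF : Frame G1 e1 e2 e3 k1 k2 k3 d1 d2 d3) (he1 : ¬ (lp : ℤ) ∣ e1 1)
    (he2 : ¬ (lp : ℤ) ∣ e2 1) (he3 : ¬ (lp : ℤ) ∣ e3 1) (hco : IsCoprime d2 d3)
    (h23 : ¬ d2 * d3 ≤ (lp : ℤ) ^ 4 * (k2 * k3)) (hr : ReflectiveM G') : False := by
  have hl0 : (lp : ℤ) ≠ 0 := by exact_mod_cast hlp.ne_zero
  have hpos' := hN.pos' hl0
  have hF1 := (hF.swap12 hN.s1)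
  have hF2 := (hF1.swap23 hN.s1)
  have hF3 := (hF.swap23 hN.s1).swap12 hN.s1
  have n23 : ∀ f, Rt G' f → Bf G' f (ψ e2) ≠ 0 → Bf G' f (ψ e3) ≠ 0 → False :=
    fun f hf h2 h3 => h23 (two_nonzero hN hl0 hF2 hco hf h2 h3)
  have nv : ∀ e, e ≠ 0 → G'.mulVec (ψ e) ≠ 0 := by
    intro e he h0
    have := hpos' (ψ e) (hN.psi_ne hl0 he)
    rw [Bf, h0, dotProduct_zero] at this
    exact lt_irrefl _ this
  obtain ⟨f, hf, hf2⟩ := exists_root_not_ker hpos' hr (nv e2 hF.ne2)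
  obtain ⟨g, hg, hg3⟩ := exists_root_not_ker hpos' hr (nv e3 hF.ne3)
  rw [dotProduct_comm] at hf2 hg3
  change Bf G' f (ψ e2) ≠ 0 at hf2
  change Bf G' g (ψ e3) ≠ 0 at hg3
  have hf3 : Bf G' f (ψ e3) = 0 := by
    by_contra h
    exact n23 f hf hf2 h
  have hg2 : Bf G' g (ψ e2) = 0 := by
    by_contra h
    exact n23 g hg h hg3
  have hf1 : Bf G' f (ψ e1) ≠ 0 := fun h => no_axis hlp h7 hN hD hF1 he2 hf h hf3
  have hg1 : Bf G' g (ψ e1) ≠ 0 := fun h => no_axis hlp h7 hN hD hF3 he3 hg h hg2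
  have hfg : Bf G' g f ≠ 0 := by
    intro h0
    have := hN.parseval hF g f
    rw [h0, hf3, hg2] at this
    have h2 := (hN.pos1 _ hF.ne2).ne'
    have h3 := (hN.pos1 _ hF.ne3).ne'
    have h4 := mul_ne_zero (mul_ne_zero hg1 hf1) (mul_ne_zero h2 h3)
    apply h4
    linarith
  obtain ⟨c, hc⟩ := hf.dvd g
  have hc0 : c ≠ 0 := by
    rintro rfl
    apply hfg
    linarith
  have hw : Rt G' (g - c • f) := hf.reflect hN.s' hpos' hg hc
  refine n23 _ hw ?_ ?_
  · rw [Bf_sub_left, Bf_smul_left, hg2, zero_sub]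
    exact neg_ne_zero.mpr (mul_ne_zero hc0 hf2)
  · rw [Bf_sub_left, Bf_smul_left, hf3, mul_zero, sub_zero]
    exact hg3

theorem core_all {lp : ℕ} (hlp : lp.Prime) (h7 : 7 ≤ lp) (hN : Nb lp G1 G' φ ψ)
    (hD : ¬ (lp : ℤ) ∣ G1.det) (hbig : 4 * (lp : ℤ) ^ 6 < G1.det) {e1 e2 e3 : Fin 3 → ℤ}
    {k1 k2 k3 d1 d2 d3 : ℤ} (hF : Frame G1 e1 e2 e3 k1 k2 k3 d1 d2 d3) (he1 : ¬ (lp : ℤ) ∣ e1 1)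
    (he2 : ¬ (lp : ℤ) ∣ e2 1) (he3 : ¬ (lp : ℤ) ∣ e3 1) (c12 : IsCoprime d1 d2)
    (c13 : IsCoprime d1 d3) (c23 : IsCoprime d2 d3) (hr : ReflectiveM G') : False := by
  by_cases h23 : d2 * d3 ≤ (lp : ℤ) ^ 4 * (k2 * k3)
  swap
  · exact core hlp h7 hN hD hF he1 he2 he3 c23 h23 hr
  by_cases h13 : d1 * d3 ≤ (lp : ℤ) ^ 4 * (k1 * k3)
  swap
  · exact core hlp h7 hN hD (hF.swap12 hN.s1) he2 he1 he3 c13 h13 hr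
  by_cases h12 : d1 * d2 ≤ (lp : ℤ) ^ 4 * (k1 * k2)
  swap
  · exact core hlp h7 hN hD ((hF.swap23 hN.s1).swap12 hN.s1) he3 he1 he2 c12 h12 hr
  have p1 := hF.p1
  have p2 := hF.p2
  have p3 := hF.p3
  obtain ⟨q1, q2, q3⟩ := hF.nonneg
  have m1 : (d1 * d2) * (d1 * d3) ≤ ((lp : ℤ) ^ 4 * (k1 * k2)) * ((lp : ℤ) ^ 4 * (k1 * k3)) := by
    gcongr
  have m2 : (d1 * d2) * (d1 * d3) * (d2 * d3) ≤
      ((lp : ℤ) ^ 4 * (k1 * k2)) * ((lp : ℤ) ^ 4 * (k1 * k3)) * ((lp : ℤ) ^ 4 * (k2 * k3)) := by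
    gcongr
  have hkk : (k1 * k2 * k3) ^ 2 ≤ 4 ^ 2 := pow_le_pow_left₀ (by positivity) hF.kk 2
  have m3 : G1.det ^ 2 ≤ (4 * (lp : ℤ) ^ 6) ^ 2 := by
    rw [← hF.prod]
    have h12 : (0 : ℤ) ≤ (lp : ℤ) ^ 12 := by positivity
    have := mul_le_mul_of_nonneg_left hkk h12
    linarith
  have h0 : (0 : ℤ) ≤ 4 * (lp : ℤ) ^ 6 := by positivity
  have := pow_lt_pow_left₀ hbig h0 (n := 2) (by norm_num)
  linarith

end Neighbor

theorem frame_false {G : Matrix (Fin 3) (Fin 3) ℤ} (hG : G.IsSymm) (hpos : PosDefM G)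
    (htr : TotallyReflectiveM G) {l : ℕ} (hl : l.Prime) (h7 : 7 ≤ l) (hD : ¬ (l : ℤ) ∣ G.det)
    (hbig : 4 * (l : ℤ) ^ 6 < G.det) {e1 e2 e3 : Fin 3 → ℤ} {k1 k2 k3 d1 d2 d3 : ℤ}
    (hF : Frame G e1 e2 e3 k1 k2 k3 d1 d2 d3) (c12 : IsCoprime d1 d2)
    (c13 : IsCoprime d1 d3) (c23 : IsCoprime d2 d3) : False := by
  have hpr := Nat.prime_iff_prime_int.mp hl
  have hl0 : (l : ℤ) ≠ 0 := by exact_mod_cast hl.ne_zero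
  have hk : ∀ k d : ℤ, (k = 1 ∨ k = 2) → d ∣ G.det → ¬ (l : ℤ) ∣ k * d := by
    intro k d hk hd h
    rcases hpr.dvd_or_dvd h with h | h
    · rcases hk with rfl | rfl <;>
        · have := Int.le_of_dvd (by norm_num) h
          omega
    · exact hD (h.trans hd)
  have a1 : ¬ (l : ℤ) ∣ Bf G e1 e1 := by
    rw [hF.n1]
    exact hk _ _ hF.h1 ⟨d2 * d3, by rw [← hF.prod]; ring⟩
  have a2 : ¬ (l : ℤ) ∣ Bf G e2 e2 := by
    rw [hF.n2]
    exact hk _ _ hF.h2 ⟨d1 * d3, by rw [← hF.prod]; ring⟩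
  have a3 : ¬ (l : ℤ) ∣ Bf G e3 e3 := by
    rw [hF.n3]
    exact hk _ _ hF.h3 ⟨d1 * d2, by rw [← hF.prod]; ring⟩
  obtain ⟨x, y, z, hx, hy, hz, hiso⟩ := iso_int hl h7 a1 a2 a3
  set v := x • e1 + y • e2 + z • e3 with hv
  have o21 : Bf G e2 e1 = 0 := by rw [Bf_comm hG]; exact hF.o12
  have o31 : Bf G e3 e1 = 0 := by rw [Bf_comm hG]; exact hF.o13
  have o32 : Bf G e3 e2 = 0 := by rw [Bf_comm hG]; exact hF.o23
  have v1 : Bf G v e1 = x * Bf G e1 e1 := by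
    simp only [hv, Bf_add_left, Bf_smul_left, o21, o31]; ring
  have v2 : Bf G v e2 = y * Bf G e2 e2 := by
    simp only [hv, Bf_add_left, Bf_smul_left, hF.o12, o32]; ring
  have v3 : Bf G v e3 = z * Bf G e3 e3 := by
    simp only [hv, Bf_add_left, Bf_smul_left, hF.o13, hF.o23]; ring
  have vv : Bf G v v = Bf G e1 e1 * x ^ 2 + Bf G e2 e2 * y ^ 2 + Bf G e3 e3 * z ^ 2 := by
    have : Bf G v v = x * Bf G v e1 + y * Bf G v e2 + z * Bf G v e3 := by
      conv_lhs => rw [hv, Bf_add_right, Bf_add_right, Bf_smul_right, Bf_smul_right, Bf_smul_right]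
    rw [this, v1, v2, v3]; ring
  have w1 : ¬ (l : ℤ) ∣ Bf G v e1 := by
    rw [v1]; exact fun h => (hpr.dvd_or_dvd h).elim hx a1
  have w2 : ¬ (l : ℤ) ∣ Bf G v e2 := by
    rw [v2]; exact fun h => (hpr.dvd_or_dvd h).elim hy a2
  have w3 : ¬ (l : ℤ) ∣ Bf G v e3 := by
    rw [v3]; exact fun h => (hpr.dvd_or_dvd h).elim hz a3
  have hv0 : v ≠ 0 := by
    intro h0
    apply w1
    rw [h0]
    simp [Bf]
  obtain ⟨f, g, hg, hf, hvf⟩ := exists_prim hv0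
  have lg : ¬ (l : ℤ) ∣ g := by
    intro h
    apply w1
    rw [hvf, Bf_smul_left]
    exact Dvd.dvd.mul_right h _
  have u : ∀ e, ¬ (l : ℤ) ∣ Bf G v e → ¬ (l : ℤ) ∣ Bf G f e := by
    intro e h h'
    apply h
    rw [hvf, Bf_smul_left]
    exact Dvd.dvd.mul_left h' _
  have hff : (l : ℤ) ^ 2 ∣ Bf G f f := by
    rw [← vv, hvf, Bf_smul_left, Bf_smul_right, ← mul_assoc] at hiso
    have hc : IsCoprime (l : ℤ) g := (Prime.coprime_iff_not_dvd hpr).mpr lg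
    exact ((hc.mul_right hc).pow_left).dvd_of_dvd_mul_left hiso
  obtain ⟨m, hm⟩ := hff
  obtain ⟨U, h, r, s, t, hU, hUf, hNF⟩ := exists_NF hG hf
  rw [hm] at hNF
  have hdet : (Uᵀ * G * U).det = G.det := by
    rw [Matrix.det_mul, Matrix.det_mul, Matrix.det_transpose, hU]; ring
  have hh : ¬ (l : ℤ) ∣ h := by
    intro hd
    apply hD
    rw [← hdet, hNF, NF_det]
    exact dvd_sub (Dvd.dvd.mul_right (Dvd.dvd.mul_right (dvd_pow_self _ two_ne_zero) _) _)
      (Dvd.dvd.mul_right (dvd_pow hd two_ne_zero) _)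
  have hc : ∀ e, U.mulVec (U.adjugate.mulVec e) = e := by
    intro e
    rw [Matrix.mulVec_mulVec, Matrix.mul_adjugate, hU, one_smul, Matrix.one_mulVec]
  have hc' : ∀ e, U.adjugate.mulVec (U.mulVec e) = e := by
    intro e
    rw [Matrix.mulVec_mulVec, Matrix.adjugate_mul, hU, one_smul, Matrix.one_mulVec]
  have hpos1 : PosDefM (Uᵀ * G * U) := by
    intro w hw
    rw [Bf_congr]
    apply hpos
    intro h0
    apply hw
    rw [← hc' w, h0, Matrix.mulVec_zero]
  have hF1 := hF.transport hU
  have key : ∀ e, ¬ (l : ℤ) ∣ Bf G v e → ¬ (l : ℤ) ∣ (U.adjugate.mulVec e) 1 := by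
    intro e he hd
    apply u e he
    have hs : U.mulVec (Pi.single 0 1) = f := by
      ext i
      rw [Matrix.mulVec_single_one]
      exact hUf i
    have h1 := Bf_congr (G := G) U (Pi.single 0 1) (U.adjugate.mulVec e)
    rw [hs, hc, hNF, Bf_NF] at h1
    rw [← h1]
    obtain ⟨w, hw⟩ := hd
    rw [hw]
    simp
    exact dvd_add ⟨l * m * (U.adjugate.mulVec e) 0, by ring⟩ ⟨h * w, by ring⟩
  have hgen := neighbor_genus hU hl h7 hh hNF
  rw [hNF] at hpos1 hF1 hdet
  have hN := nb_NF hpos1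
  have hr := htr _ hN.s' (hN.pos' hl0) hgen
  rw [← hdet] at hD hbig
  exact core_all hl h7 hN hD hbig hF1 (key _ w1) (key _ w2) (key _ w3) c12 c13 c23 hr

/-- Corollary 3.11: a strongly square free, totally-reflective, positive definite ternary
lattice has a determinant with at most 9 (pairwise distinct) prime factors. -/
theorem ssf_totally_reflective_dim3_num_primes_le_nine
    (G : Matrix (Fin 3) (Fin 3) ℤ) (hsymm : G.IsSymm) (hpos : PosDefM G)
    (hssf : StronglySquareFreeM G) (htr : TotallyReflectiveM G)
    (s : ℕ) (q : Fin s → ℕ) (hq : ∀ i, (q i).Prime) (hinj : Function.Injective q)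
    (hdet : G.det = ∏ i, (q i : ℤ)) : s ≤ 9 := by
  by_contra hs
  have hs10 : 10 ≤ s := by omega
  set T : Finset ℕ := Finset.univ.image q with hT
  have hTp : ∀ p ∈ T, p.Prime := by
    intro p hp
    obtain ⟨i, -, rfl⟩ := Finset.mem_image.mp hp
    exact hq i
  have hTc : T.card = s := by
    rw [hT, Finset.card_image_of_injective _ hinj, Finset.card_univ, Fintype.card_fin]
  have hTprod : ∏ p ∈ T, p = ∏ i, q i := by
    rw [hT, Finset.prod_image (fun a _ b _ h => hinj h)]
  have hsq : Squarefree G.det := by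
    rw [hdet]
    refine Finset.squarefree_prod_of_pairwise_isCoprime ?_ ?_
    · intro i _ j _ hij
      have : Nat.Coprime (q i) (q j) := (Nat.coprime_primes (hq i) (hq j)).mpr (fun h => hij (hinj h))
      exact (Nat.isCoprime_iff_coprime.mpr this).isRelPrime
    · intro i _
      exact (Nat.prime_iff_prime_int.mp (hq i)).squarefree
  have h4 : ¬ (4 : ℤ) ∣ G.det := by
    intro h
    have h2 := hsq 2 (by norm_num; exact h)
    rw [Int.isUnit_iff] at h2
    omega
  have hr : ReflectiveM G := by
    apply htr G hsymm hpos
    intro p _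
    exact ⟨1, by simp, by simp⟩
  obtain ⟨e1, e2, e3, k1, k2, k3, d1, d2, d3, hF⟩ := exists_frame hsymm hpos hr h4
  obtain ⟨l, hl, h7, hlT, hbig⟩ := exists_ell hTp (by omega)
  have hcop : ∀ a b : ℤ, a * b ∣ G.det → IsCoprime a b := fun a b h =>
    isRelPrime_iff_isCoprime.mp (IsRelPrime.of_squarefree_mul (hsq.squarefree_of_dvd h))
  refine frame_false hsymm hpos htr hl h7 ?_ ?_ hF (hcop _ _ ⟨d3, hF.prod.symm⟩)
    (hcop _ _ ⟨d2, by rw [← hF.prod]; ring⟩) (hcop _ _ ⟨d1, by rw [← hF.prod]; ring⟩)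
  · intro hd
    rw [hdet, Prime.dvd_finsetProd_iff (Nat.prime_iff_prime_int.mp hl)] at hd
    obtain ⟨i, -, hi⟩ := hd
    have : l = q i := (Nat.prime_dvd_prime_iff_eq hl (hq i)).mp (by exact_mod_cast hi)
    exact hlT (by rw [this, hT]; exact Finset.mem_image_of_mem q (Finset.mem_univ i))
  · rw [hdet]
    rw [hTprod] at hbig
    exact_mod_cast hbig
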